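/- arXiv:1706.02343 — 4 statements merged into one kernel-verified Lean document; each statement's English description precedes it below -/
import Mathlib

section
/- (Core of Remark 0.5) Let φ : (−1,1) → ℝ be operator convex on (−1,1), and suppose that the function x ↦ φ(x²) is also operator convex on (−1,1). Then φ is operator monotone on (−1,1). -/
open Matrix Set
open scoped ComplexOrder

/-- `f` is operator monotone on `I ⊆ ℝ`: for every `n ≥ 1` and all `n×n` Hermitian complex
matrices `A, B` with spectra (eigenvalues) contained in `I`, `A ≤ B` in the Loewner order
implies `f(A) ≤ f(B)`, where `f(A)` is given by the functional calculus. -/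
def OperatorMonotoneOn (f : ℝ → ℝ) (I : Set ℝ) : Prop :=
  ∀ (n : ℕ), 0 < n → ∀ (A B : Matrix (Fin n) (Fin n) ℂ)
    (hA : A.IsHermitian) (hB : B.IsHermitian),
    (∀ i, hA.eigenvalues i ∈ I) → (∀ i, hB.eigenvalues i ∈ I) →
    (B - A).PosSemidef → (hB.cfc f - hA.cfc f).PosSemidef

/-- `f` is operator convex on `I ⊆ ℝ`: for every `n ≥ 1`, every `t ∈ [0,1]` and all `n×n`
Hermitian complex matrices `A, B` with spectra contained in `I`,
`f(tA + (1−t)B) ≤ t·f(A) + (1−t)·f(B)` in the Loewner order. -/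
def OperatorConvexOn (f : ℝ → ℝ) (I : Set ℝ) : Prop :=
  ∀ (n : ℕ), 0 < n → ∀ t : ℝ, t ∈ Set.Icc (0 : ℝ) 1 →
  ∀ (A B : Matrix (Fin n) (Fin n) ℂ) (hA : A.IsHermitian) (hB : B.IsHermitian)
    (hAB : ((t : ℂ) • A + ((1 : ℂ) - (t : ℂ)) • B).IsHermitian),
    (∀ i, hA.eigenvalues i ∈ I) → (∀ i, hB.eigenvalues i ∈ I) →
    ((t : ℂ) • hA.cfc f + ((1 : ℂ) - (t : ℂ)) • hB.cfc f - hAB.cfc f).PosSemidef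

/-- `f` is strongly operator convex on `I ⊆ ℝ`: there is `x₀ ∈ I` such that for every `n ≥ 1`,
every `n×n` orthogonal projection `P` and every `n×n` Hermitian matrix `H` with spectrum
contained in `I`, `P·f(PHP + x₀(1−P))·P ≤ f(H)` in the Loewner order. -/
def StronglyOperatorConvexOn (f : ℝ → ℝ) (I : Set ℝ) : Prop :=
  ∃ x₀ ∈ I, ∀ (n : ℕ), 0 < n → ∀ (P H : Matrix (Fin n) (Fin n) ℂ),
    P.IsHermitian → P * P = P →
    ∀ (hH : H.IsHermitian)
      (hK : (P * H * P + (x₀ : ℂ) • ((1 : Matrix (Fin n) (Fin n) ℂ) - P)).IsHermitian),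
    (∀ i, hH.eigenvalues i ∈ I) →
    (hH.cfc f - P * hK.cfc f * P).PosSemidef


namespace Matrix.IsHermitian

variable {n : Type*} [Fintype n] [DecidableEq n] {A : Matrix n n ℂ}

lemma cfc_eq_mul (hA : A.IsHermitian) (f : ℝ → ℝ) :
    hA.cfc f = (hA.eigenvectorUnitary : Matrix n n ℂ) *
      diagonal (fun i => (f (hA.eigenvalues i) : ℂ)) *
      star (hA.eigenvectorUnitary : Matrix n n ℂ) := by
  rw [IsHermitian.cfc, Unitary.conjStarAlgAut_apply]
  rfl

lemma eq_mul_diagonal_mul (hA : A.IsHermitian) :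
    A = (hA.eigenvectorUnitary : Matrix n n ℂ) *
      diagonal (fun i => (hA.eigenvalues i : ℂ)) *
      star (hA.eigenvectorUnitary : Matrix n n ℂ) := by
  conv_lhs => rw [hA.spectral_theorem, Unitary.conjStarAlgAut_apply]
  rfl

lemma cfc_mulVec_of_mulVec_eq_smul (hA : A.IsHermitian) (f : ℝ → ℝ) {v : n → ℂ} {y : ℝ}
    (hv : A *ᵥ v = (y : ℂ) • v) : hA.cfc f *ᵥ v = (f y : ℂ) • v := by
  set U : Matrix n n ℂ := (hA.eigenvectorUnitary : Matrix n n ℂ) with hU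
  have h1 : star U * U = 1 := Unitary.coe_star_mul_self hA.eigenvectorUnitary
  have h2 : U * star U = 1 := Unitary.coe_mul_star_self hA.eigenvectorUnitary
  set w := star U *ᵥ v with hw
  have hUw : U *ᵥ w = v := by rw [hw, mulVec_mulVec, h2, one_mulVec]
  have hd : diagonal (fun i => (hA.eigenvalues i : ℂ)) *ᵥ w = (y : ℂ) • w := by
    have := congrArg (fun x => star U *ᵥ x) hv
    simp only [mulVec_smul] at this
    rw [hw, ← this]
    conv_rhs => rw [hA.eq_mul_diagonal_mul]
    rw [← hU, mulVec_mulVec, mulVec_mulVec, ← mul_assoc, ← mul_assoc, h1, one_mul]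
  have hf : diagonal (fun i => (f (hA.eigenvalues i) : ℂ)) *ᵥ w = (f y : ℂ) • w := by
    ext i
    have hi := congrFun hd i
    simp only [mulVec_diagonal, Pi.smul_apply, smul_eq_mul] at hi ⊢
    rcases eq_or_ne (w i) 0 with h0 | h0
    · simp [h0]
    · have : hA.eigenvalues i = y := by exact_mod_cast mul_right_cancel₀ h0 hi
      rw [this]
  rw [cfc_eq_mul, ← hU, ← mulVec_mulVec, ← mulVec_mulVec, ← hw, hf, mulVec_smul, hUw]

lemma dotProduct_cfc_mulVec (hA : A.IsHermitian) (f : ℝ → ℝ) (v : n → ℂ) :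
    star v ⬝ᵥ (hA.cfc f *ᵥ v) = ∑ i, (f (hA.eigenvalues i) : ℂ) *
      (star ((star (hA.eigenvectorUnitary : Matrix n n ℂ) *ᵥ v) i) *
        (star (hA.eigenvectorUnitary : Matrix n n ℂ) *ᵥ v) i) := by
  rw [cfc_eq_mul, ← mulVec_mulVec, ← mulVec_mulVec, dotProduct_mulVec]
  have : star v ᵥ* (hA.eigenvectorUnitary : Matrix n n ℂ) =
      star (star (hA.eigenvectorUnitary : Matrix n n ℂ) *ᵥ v) := by
    rw [star_mulVec, star_eq_conjTranspose, conjTranspose_conjTranspose]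
  rw [this]
  simp only [dotProduct, mulVec_diagonal, Pi.star_apply]
  exact Finset.sum_congr rfl fun i _ => by ring

lemma isHermitian_cfc (hA : A.IsHermitian) (f : ℝ → ℝ) : (hA.cfc f).IsHermitian := by
  rw [← hA.cfc_eq]
  exact cfc_predicate f A

lemma eigenvalues_mem_of_eq_conj_diagonal (hA : A.IsHermitian) {U : Matrix n n ℂ}
    (hU : U * U = 1) {t : n → ℝ} (h : A = U * diagonal (fun i => (t i : ℂ)) * U) (i : n) :
    ∃ j, hA.eigenvalues i = t j := by
  set v : n → ℂ := (hA.eigenvectorBasis i).ofLp with hv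
  have hv0 : v ≠ 0 := by
    intro h0
    apply (hA.eigenvectorBasis.orthonormal.ne_zero i)
    ext j
    exact congrFun h0 j
  have hAv : A *ᵥ v = (hA.eigenvalues i : ℂ) • v := by
    have := hA.mulVec_eigenvectorBasis i
    simpa using this
  have hw : diagonal (fun i => (t i : ℂ)) *ᵥ (U *ᵥ v) = (hA.eigenvalues i : ℂ) • (U *ᵥ v) := by
    rw [← mulVec_smul, ← hAv, h]
    simp only [mulVec_mulVec, ← mul_assoc, hU, one_mul]
  have hw0 : U *ᵥ v ≠ 0 := by
    intro h0
    apply hv0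
    rw [← one_mulVec v, ← hU, ← mulVec_mulVec, h0, mulVec_zero]
  obtain ⟨j, hj⟩ := Function.ne_iff.mp hw0
  refine ⟨j, ?_⟩
  have := congrFun hw j
  simp only [mulVec_diagonal, Pi.smul_apply, smul_eq_mul] at this
  exact_mod_cast (mul_right_cancel₀ hj this).symm

end Matrix.IsHermitian

namespace OperatorConvexOn

lemma sum_mul_dotProduct_le {f : ℝ → ℝ} {I : Set ℝ} (hf : OperatorConvexOn f I) {m : ℕ}
    {t : Fin m → ℝ} (ht : ∀ i, t i ∈ I) {ι : Type*} [Fintype ι] {u : Fin m → ℝ}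
    {e : ι → Fin m → ℝ} {y : ι → ℝ} (he : ∀ j i, t i * e j i = y j * e j i + u i)
    (hu : ∀ j, u ⬝ᵥ e j = 0) (c : ι → ℝ) :
    ∑ j, ∑ k, c j * c k * f (y j) * (e k ⬝ᵥ e j) ≤ ∑ i, f (t i) * (∑ j, c j * e j i) ^ 2 := by
  rcases Nat.eq_zero_or_pos m with rfl | hm
  · simp [dotProduct]
  set X : Matrix (Fin m) (Fin m) ℂ := diagonal (fun i => (t i : ℂ)) with hX
  set w : Fin m → ℂ := fun i => (u i : ℂ) with hw
  set E : ι → Fin m → ℂ := fun j i => (e j i : ℂ) with hE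
  set κ : ℂ := 2 / (w ⬝ᵥ w) with hκ
  have hww : w ⬝ᵥ w = ((u ⬝ᵥ u : ℝ) : ℂ) := by simp [dotProduct, hw]
  have hκs : star κ = κ := by
    rw [hκ, hww]
    simp
  set U : Matrix (Fin m) (Fin m) ℂ := 1 - κ • vecMulVec w w with hU
  have hUv : ∀ v, U *ᵥ v = v - (κ * (w ⬝ᵥ v)) • w := by
    intro v
    rw [hU, sub_mulVec, one_mulVec, smul_mulVec, vecMulVec_mulVec]
    ext i
    simp [mul_comm, mul_left_comm]
  have hUw : U *ᵥ w = -w := by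
    rw [hUv]
    rcases eq_or_ne (w ⬝ᵥ w) 0 with h0 | h0
    · have : u = 0 := by
        rw [hww] at h0
        exact dotProduct_self_eq_zero.mp (by exact_mod_cast h0)
      have : w = 0 := by ext i; simp [hw, this]
      simp [this]
    · rw [hκ, div_mul_cancel₀ _ h0, two_smul]
      abel
  have hUE : ∀ j, U *ᵥ E j = E j := by
    intro j
    have : w ⬝ᵥ E j = ((u ⬝ᵥ e j : ℝ) : ℂ) := by simp [dotProduct, hw, hE]
    rw [hUv, this, hu]
    simp
  have hUU : U * U = 1 := by
    apply Matrix.mulVec_injective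
    ext v : 1
    rw [← mulVec_mulVec, one_mulVec, hUv v, mulVec_sub, mulVec_smul, hUw, hUv]
    simp
  have hUH : Uᴴ = U := by
    rw [hU, conjTranspose_sub, conjTranspose_one, conjTranspose_smul, hκs,
      conjTranspose_vecMulVec]
    congr
    all_goals
      ext i
      simp [hw]
  have hXH : X.IsHermitian := by
    rw [hX]
    exact isHermitian_diagonal_of_self_adjoint _ (by ext i; simp)
  have hYH : (U * X * U).IsHermitian := by
    have := isHermitian_mul_mul_conjTranspose U hXH
    rwa [hUH] at this
  have hMH : (((1 / 2 : ℝ) : ℂ) • X + ((1 : ℂ) - ((1 / 2 : ℝ) : ℂ)) • (U * X * U)).IsHermitian := by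
    rw [IsHermitian, conjTranspose_add, conjTranspose_smul, conjTranspose_smul, hXH.eq, hYH.eq]
    simp
  have key := hf m hm (1 / 2) ⟨by norm_num, by norm_num⟩ X (U * X * U) hXH hYH hMH
    (fun i => by
      obtain ⟨j, hj⟩ := hXH.eigenvalues_mem_of_eq_conj_diagonal (U := 1) (by simp)
        (t := t) (by simp [hX]) i
      rw [hj]; exact ht j)
    (fun i => by
      obtain ⟨j, hj⟩ := hYH.eigenvalues_mem_of_eq_conj_diagonal hUU (t := t) (by rw [hX]) i
      rw [hj]; exact ht j)
  set V : Fin m → ℂ := fun i => ((∑ j, c j * e j i : ℝ) : ℂ) with hV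
  have hVE : V = ∑ j, (c j : ℂ) • E j := by
    ext i
    simp [hV, hE, Finset.sum_apply]
  have hUV : U *ᵥ V = V := by
    rw [hVE, mulVec_sum]
    exact Finset.sum_congr rfl fun j _ => by rw [mulVec_smul, hUE]
  have hXE : ∀ j, X *ᵥ E j = (y j : ℂ) • E j + w := by
    intro j
    ext i
    simp only [hX, mulVec_diagonal, Pi.add_apply, Pi.smul_apply, smul_eq_mul, hE, hw]
    exact_mod_cast he j i
  have hME : ∀ j, (((1 / 2 : ℝ) : ℂ) • X + ((1 : ℂ) - ((1 / 2 : ℝ) : ℂ)) • (U * X * U)) *ᵥ E j =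
      (y j : ℂ) • E j := by
    intro j
    rw [add_mulVec, smul_mulVec, smul_mulVec, ← mulVec_mulVec, hUE, ← mulVec_mulVec, hXE,
      mulVec_add, mulVec_smul, hUE, hUw]
    ext i
    simp
    ring
  have hMV : hMH.cfc f *ᵥ V = ∑ j, ((c j * f (y j) : ℝ) : ℂ) • E j := by
    rw [hVE, mulVec_sum]
    refine Finset.sum_congr rfl fun j _ => ?_
    rw [mulVec_smul, hMH.cfc_mulVec_of_mulVec_eq_smul f (hME j), smul_smul]
    simp
  set Z : Fin m → ℂ := fun i => (f (t i) : ℂ) * V i with hZ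
  have hsing : ∀ v : Fin m → ℂ, v = ∑ i, Pi.single i (v i) := fun v =>
    (Finset.univ_sum_single v).symm
  have hXs : ∀ i (a : ℂ), X *ᵥ Pi.single i a = (t i : ℂ) • Pi.single i a := by
    intro i a
    ext k
    simp only [hX, mulVec_diagonal, Pi.smul_apply, smul_eq_mul]
    rcases eq_or_ne k i with rfl | h
    · rfl
    · simp [h]
  have hXV : hXH.cfc f *ᵥ V = Z := by
    rw [hsing V, hsing Z, mulVec_sum]
    refine Finset.sum_congr rfl fun i _ => ?_
    rw [hXH.cfc_mulVec_of_mulVec_eq_smul f (hXs i _), ← Pi.single_smul]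
    simp [hZ]
  have hYV : hYH.cfc f *ᵥ V = U *ᵥ Z := by
    conv_lhs => rw [← hUV, hsing V]
    rw [hsing Z, mulVec_sum, mulVec_sum, mulVec_sum]
    refine Finset.sum_congr rfl fun i _ => ?_
    rw [hYH.cfc_mulVec_of_mulVec_eq_smul f (y := t i), ← mulVec_smul, ← Pi.single_smul]
    · simp [hZ]
    · rw [mulVec_mulVec, mul_assoc, hUU, mul_one, ← mulVec_mulVec, hXs, mulVec_smul]
  have hsV : star V = V := by ext i; simp [hV]
  have hVU : V ⬝ᵥ (U *ᵥ Z) = V ⬝ᵥ Z := by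
    rw [dotProduct_mulVec]
    congr 1
    have := congrArg star hUV
    rwa [star_mulVec, hUH, hsV] at this
  have hkey := key.dotProduct_mulVec_nonneg V
  rw [sub_mulVec, add_mulVec, smul_mulVec, smul_mulVec, hXV, hYV, hMV, hsV, dotProduct_sub,
    dotProduct_add, dotProduct_smul, dotProduct_smul, hVU] at hkey
  have h1 : V ⬝ᵥ Z = ((∑ i, f (t i) * (∑ j, c j * e j i) ^ 2 : ℝ) : ℂ) := by
    simp only [dotProduct, hZ, hV]
    push_cast
    exact Finset.sum_congr rfl fun i _ => by ring
  have h2 : V ⬝ᵥ ∑ j, ((c j * f (y j) : ℝ) : ℂ) • E j =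
      ((∑ j, ∑ k, c j * c k * f (y j) * (e k ⬝ᵥ e j) : ℝ) : ℂ) := by
    rw [dotProduct_sum, Complex.ofReal_sum]
    refine Finset.sum_congr rfl fun j _ => ?_
    rw [hVE, sum_dotProduct, Complex.ofReal_sum]
    refine Finset.sum_congr rfl fun k _ => ?_
    have : E k ⬝ᵥ E j = ((e k ⬝ᵥ e j : ℝ) : ℂ) := by simp [dotProduct, hE]
    rw [smul_dotProduct, dotProduct_smul, this]
    simp only [smul_eq_mul]
    push_cast
    ring
  rw [h1, h2] at hkey
  simp only [smul_eq_mul] at hkey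
  have h3 : (0 : ℝ) ≤ 1 / 2 * (∑ i, f (t i) * (∑ j, c j * e j i) ^ 2) +
      (1 - 1 / 2) * (∑ i, f (t i) * (∑ j, c j * e j i) ^ 2) -
      ∑ j, ∑ k, c j * c k * f (y j) * (e k ⬝ᵥ e j) := by
    exact_mod_cast hkey
  linarith

end OperatorConvexOn

section DividedDifference

open Polynomial Lagrange

lemma prod_erase_sub_pos_mul_neg_one_pow {n : ℕ} {t : Fin (2 * n + 1) → ℝ} (ht : StrictMono t)
    (i : Fin (2 * n + 1)) : 0 < (-1) ^ (i : ℕ) * ∏ j ∈ Finset.univ.erase i, (t i - t j) := by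
  have hsplit : Finset.univ.erase i = Finset.Iio i ∪ Finset.Ioi i := by
    ext j
    simp
  have hdisj : Disjoint (Finset.Iio i) (Finset.Ioi i) := by
    rw [Finset.disjoint_left]
    intro j hj hj'
    simp only [Finset.mem_Iio, Finset.mem_Ioi] at hj hj'
    exact lt_asymm hj hj'
  have hneg : ∏ j ∈ Finset.Ioi i, (t i - t j) =
      (-1) ^ (i : ℕ) * ∏ j ∈ Finset.Ioi i, (t j - t i) := by
    have : ∀ j ∈ Finset.Ioi i, t i - t j = (-1) * (t j - t i) := fun j _ => by ring
    rw [Finset.prod_congr rfl this, Finset.prod_mul_distrib, Finset.prod_const, Fin.card_Ioi]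
    congr 1
    have hi : (i : ℕ) < 2 * n + 1 := i.2
    have : 2 * n + 1 - 1 - (i : ℕ) + 2 * i = 2 * n + i := by omega
    have h2 := congrArg (fun k => (-1 : ℝ) ^ k) this
    simpa [pow_add, pow_mul] using h2
  rw [hsplit, Finset.prod_union hdisj, hneg]
  have h1 : 0 < ∏ j ∈ Finset.Iio i, (t i - t j) :=
    Finset.prod_pos fun j hj => sub_pos.mpr (ht (Finset.mem_Iio.mp hj))
  have h2 : 0 < ∏ j ∈ Finset.Ioi i, (t j - t i) :=
    Finset.prod_pos fun j hj => sub_pos.mpr (ht (Finset.mem_Ioi.mp hj))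
  have h3 : ((-1 : ℝ) ^ (i : ℕ)) * (-1) ^ (i : ℕ) = 1 := by
    rw [← mul_pow]; simp
  calc (0 : ℝ) < 1 * ((∏ j ∈ Finset.Iio i, (t i - t j)) * ∏ j ∈ Finset.Ioi i, (t j - t i)) := by
        positivity
    _ = _ := by
        linear_combination (-((∏ j ∈ Finset.Iio i, (t i - t j)) *
          ∏ j ∈ Finset.Ioi i, (t j - t i))) * h3

lemma card_filter_odd_fin (n : ℕ) :
    (Finset.univ.filter fun i : Fin (2 * n + 1) => Odd (i : ℕ)).card = n := by
  have : (Finset.univ.filter fun i : Fin (2 * n + 1) => Odd (i : ℕ)) =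
      Finset.univ.map ⟨fun k : Fin n => (⟨2 * k + 1, by omega⟩ : Fin (2 * n + 1)),
        fun a b h => by
          simp only [Fin.mk.injEq] at h
          exact Fin.ext (by omega)⟩ := by
    ext i
    simp only [Finset.mem_filter, Finset.mem_univ, true_and, Finset.mem_map]
    constructor
    · rintro ⟨k, hk⟩
      exact ⟨⟨k, by omega⟩, Fin.ext hk.symm⟩
    · rintro ⟨k, rfl⟩
      exact ⟨k, rfl⟩
  rw [this, Finset.card_map, Finset.card_univ, Fintype.card_fin]

namespace OperatorConvexOn

lemma sum_sq_mul_div_prod_nonneg {f : ℝ → ℝ} {I : Set ℝ} (hf : OperatorConvexOn f I) {n : ℕ}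
    {t : Fin (2 * n + 1) → ℝ} (ht : StrictMono t) (htI : ∀ i, t i ∈ I) {q : ℝ[X]}
    (hq : q.degree < n) :
    0 ≤ ∑ i, q.eval (t i) ^ 2 * f (t i) / ∏ j ∈ Finset.univ.erase i, (t i - t j) := by
  set W : Fin (2 * n + 1) → ℝ := fun i => ∏ j ∈ Finset.univ.erase i, (t i - t j) with hW
  set Y := Finset.univ.filter fun i : Fin (2 * n + 1) => Odd (i : ℕ) with hY
  have hYc : Y.card = n := card_filter_odd_fin n
  have hinj : Function.Injective t := ht.injective
  have hWpos : ∀ i, i ∉ Y → 0 < W i := by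
    intro i hi
    have h := prod_erase_sub_pos_mul_neg_one_pow ht i
    have he : Even (i : ℕ) := by simpa [hY] using hi
    simpa [he.neg_one_pow] using h
  have hW0 : ∀ i, W i ≠ 0 := fun i => Finset.prod_ne_zero_iff.mpr fun j hj =>
    sub_ne_zero.mpr fun h => (Finset.ne_of_mem_erase hj) (hinj h).symm
  set s : Fin (2 * n + 1) → ℝ := fun i => if i ∈ Y then 0 else √(W i)⁻¹ with hs
  have hss : ∀ p : Fin (2 * n + 1) → ℝ,
      ∑ i, s i ^ 2 * p i = ∑ i, p i / W i - ∑ i ∈ Y, p i / W i := by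
    intro p
    rw [← Finset.sum_compl_add_sum Y fun i => p i / W i, add_sub_cancel_right,
      ← Finset.sum_compl_add_sum Y]
    have h0 : ∑ i ∈ Y, s i ^ 2 * p i = 0 :=
      Finset.sum_eq_zero fun i hi => by simp [hs, hi]
    rw [h0, add_zero]
    refine Finset.sum_congr rfl fun i hi => ?_
    have hi' : i ∉ Y := Finset.mem_compl.mp hi
    simp only [hs, hi', if_false]
    rw [Real.sq_sqrt (inv_nonneg.mpr (hWpos i hi').le)]
    field_simp
  have hL : ∀ p : ℝ[X], p.degree < (2 * n : ℕ) → ∑ i, p.eval (t i) / W i = 0 := by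
    intro p hp
    have h := coeff_eq_sum (s := Finset.univ) (v := t) hinj.injOn (P := p)
      (hp.trans (by simp only [Finset.card_univ, Fintype.card_fin]; exact_mod_cast Nat.lt_succ_self _))
    rw [← h]
    simp only [Finset.card_univ, Fintype.card_fin, Nat.add_sub_cancel]
    exact coeff_eq_zero_of_degree_lt hp
  set ℓ : Fin (2 * n + 1) → ℝ[X] := fun j => nodal (Y.erase j) t with hℓ
  have hℓd : ∀ j ∈ Y, (ℓ j).degree = (n - 1 : ℕ) := by
    intro j hj
    rw [hℓ, degree_nodal, Finset.card_erase_of_mem hj, hYc]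
  have hℓ0 : ∀ j ∈ Y, ∀ k ∈ Y, j ≠ k → (ℓ j).eval (t k) = 0 := fun j _ k hk hjk =>
    eval_nodal_at_node (Finset.mem_erase.mpr ⟨hjk.symm, hk⟩)
  have hℓne : ∀ j, (ℓ j).eval (t j) ≠ 0 := fun j => eval_nodal_not_at_node fun k hk h =>
    (Finset.ne_of_mem_erase hk) (hinj h).symm
  have hn : ∀ j ∈ Y, 0 < n := fun j hj => hYc ▸ Finset.card_pos.mpr ⟨j, hj⟩
  set c : {j // j ∈ Y} → ℝ := fun j => q.eval (t j) / (ℓ j).eval (t j) with hc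
  have hqsum : q = ∑ j : {j // j ∈ Y}, C (c j) * ℓ j := by
    refine eq_of_degrees_lt_of_eval_index_eq Y hinj.injOn (by rwa [hYc]) ?_ ?_
    · rw [hYc]
      refine mem_degreeLT.mp (Submodule.sum_mem _ ?_)
      rintro ⟨j, hj⟩ -
      refine mem_degreeLT.mpr ?_
      rw [C_mul']
      refine lt_of_le_of_lt (degree_smul_le _ _) ?_
      rw [hℓd j hj]
      exact_mod_cast Nat.sub_lt (hn j hj) one_pos
    · intro k hk
      rw [eval_finsetSum, Finset.sum_eq_single (⟨k, hk⟩ : {j // j ∈ Y})]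
      · simp only [eval_mul, eval_C, hc]
        rw [div_mul_cancel₀ _ (hℓne k)]
      · rintro ⟨j, hj⟩ - hjk
        rw [eval_mul, hℓ0 j hj k hk (fun h => hjk (Subtype.ext h)), mul_zero]
      · simp
  have key := hf.sum_mul_dotProduct_le htI (ι := {j // j ∈ Y})
    (u := fun i => s i * (nodal Y t).eval (t i)) (e := fun j i => s i * (ℓ j).eval (t i))
    (y := fun j => t j) (by
      rintro ⟨j, hj⟩ i
      simp only [hℓ]
      rw [nodal_eq_mul_nodal_erase hj, eval_mul, eval_sub, eval_X, eval_C]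
      ring)
    (by
      rintro ⟨j, hj⟩
      have h1 := hss fun i => (nodal Y t * ℓ j).eval (t i)
      have h2 : ∑ i ∈ Y, (nodal Y t * ℓ j).eval (t i) / W i = 0 :=
        Finset.sum_eq_zero fun i hi => by rw [eval_mul, eval_nodal_at_node hi]; simp
      rw [h2, hL] at h1
      · simp only [sub_zero] at h1
        rw [← h1, dotProduct]
        refine Finset.sum_congr rfl fun i _ => ?_
        rw [eval_mul]
        ring
      · rw [degree_mul, hℓd j hj, degree_nodal, hYc]
        have := hn j hj
        exact_mod_cast (by omega : n + (n - 1) < 2 * n))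
    c
  have hee : ∀ j k : {j // j ∈ Y}, ((fun i => s i * (ℓ k).eval (t i)) ⬝ᵥ
      fun i => s i * (ℓ j).eval (t i)) =
      if k = j then -((ℓ j).eval (t j) ^ 2 / W j) else 0 := by
    rintro ⟨j, hj⟩ ⟨k, hk⟩
    have h1 := hss fun i => (ℓ k * ℓ j).eval (t i)
    rw [hL] at h1
    · have h3 : ((fun i => s i * (ℓ k).eval (t i)) ⬝ᵥ fun i => s i * (ℓ j).eval (t i)) =
          ∑ i, s i ^ 2 * (ℓ k * ℓ j).eval (t i) := by
        rw [dotProduct]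
        refine Finset.sum_congr rfl fun i _ => ?_
        rw [eval_mul]
        ring
      rw [h3, h1, zero_sub]
      split_ifs with h
      · obtain rfl : k = j := congrArg Subtype.val h
        rw [Finset.sum_eq_single k]
        · rw [eval_mul, sq]
        · intro i hi hik
          rw [eval_mul, hℓ0 k hk i hi hik.symm]
          simp
        · exact fun h' => absurd hk h'
      · have hkj : k ≠ j := fun h' => h (Subtype.ext h')
        rw [neg_eq_zero]
        refine Finset.sum_eq_zero fun i hi => ?_
        rw [eval_mul]
        rcases eq_or_ne k i with rfl | hki
        · rw [hℓ0 j hj k hk hkj.symm]; simp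
        · rw [hℓ0 k hk i hi hki]; simp
    · rw [degree_mul, hℓd j hj, hℓd k hk]
      have := hn j hj
      exact_mod_cast (by omega : (n - 1) + (n - 1) < 2 * n)
  simp only [hee] at key
  have hl : ∑ j : {j // j ∈ Y}, ∑ k : {j // j ∈ Y}, c j * c k * f (t j) *
      (if k = j then -((ℓ j).eval (t j) ^ 2 / W j) else 0) =
      -∑ j ∈ Y, q.eval (t j) ^ 2 * f (t j) / W j := by
    rw [← Finset.sum_coe_sort Y, ← Finset.sum_neg_distrib]
    refine Finset.sum_congr rfl fun j _ => ?_
    rw [Finset.sum_eq_single j]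
    · have := hℓne j
      simp only [hc, if_true]
      field_simp
    · intro k _ hkj
      simp [hkj]
    · simp
  have hr : ∑ i, f (t i) * (∑ j : {j // j ∈ Y}, c j * (s i * (ℓ j).eval (t i))) ^ 2 =
      ∑ i, s i ^ 2 * (q.eval (t i) ^ 2 * f (t i)) := by
    refine Finset.sum_congr rfl fun i _ => ?_
    have : ∑ j : {j // j ∈ Y}, c j * (s i * (ℓ j).eval (t i)) = s i * q.eval (t i) := by
      conv_rhs => rw [hqsum, eval_finsetSum, Finset.mul_sum]
      refine Finset.sum_congr rfl fun j _ => ?_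
      rw [eval_mul, eval_C]
      ring
    rw [this]
    ring
  rw [hl, hr, hss] at key
  linarith

lemma sum_finset_sq_mul_div_prod_nonneg {f : ℝ → ℝ} {I : Set ℝ} (hf : OperatorConvexOn f I)
    {n : ℕ} {T : Finset ℝ} (hT : T.card = 2 * n + 1) (hTI : ∀ x ∈ T, x ∈ I) {q : ℝ[X]}
    (hq : q.degree < n) :
    0 ≤ ∑ x ∈ T, q.eval x ^ 2 * f x / ∏ y ∈ T.erase x, (x - y) := by
  have h := hf.sum_sq_mul_div_prod_nonneg (T.orderEmbOfFin hT).strictMono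
    (fun i => hTI _ (T.orderEmbOfFin_mem hT i)) hq
  convert h using 1
  have hmap : T = Finset.univ.map (T.orderEmbOfFin hT).toEmbedding := by
    rw [Finset.map_orderEmbOfFin_univ]
  have hmap' : ∀ i, T.erase (T.orderEmbOfFin hT i) =
      (Finset.univ.erase i).map (T.orderEmbOfFin hT).toEmbedding := by
    intro i
    rw [Finset.map_erase, ← hmap]
    rfl
  calc _ = ∑ x ∈ Finset.univ.map (T.orderEmbOfFin hT).toEmbedding,
        q.eval x ^ 2 * f x / ∏ y ∈ T.erase x, (x - y) := by rw [← hmap]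
    _ = _ := by
      rw [Finset.sum_map]
      refine Finset.sum_congr rfl fun i _ => ?_
      have := hmap' i
      simp only [RelEmbedding.coe_toEmbedding] at this ⊢
      rw [this, Finset.prod_map]
      rfl

end OperatorConvexOn

end DividedDifference

section SymmetricNewton

open Polynomial Lagrange

lemma sum_div_prod_erase_union {f : ℝ → ℝ} {N R : Finset ℝ} (hNR : Disjoint N R)
    (hR : R.Nonempty) {p : ℝ[X]} (hp : p.degree < N.card) (hpN : ∀ y ∈ N, f y = p.eval y) :
    ∑ x ∈ N ∪ R, f x / ∏ y ∈ (N ∪ R).erase x, (x - y) =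
      ∑ x ∈ R, (f x - p.eval x) / ((∏ y ∈ N, (x - y)) * ∏ y ∈ R.erase x, (x - y)) := by
  have hcard : (N ∪ R).card = N.card + R.card := Finset.card_union_of_disjoint hNR
  have hRpos : 0 < R.card := hR.card_pos
  have hz : ∑ x ∈ N ∪ R, p.eval x / ∏ y ∈ (N ∪ R).erase x, (x - y) = 0 := by
    have h := coeff_eq_sum (s := N ∪ R) (v := (id : ℝ → ℝ)) Function.injective_id.injOn (P := p)
      (hp.trans (by rw [hcard]; exact_mod_cast (by omega : N.card < N.card + R.card)))
    simp only [id] at h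
    rw [← h]
    refine coeff_eq_zero_of_degree_lt (hp.trans_le ?_)
    rw [hcard]
    exact_mod_cast (by omega : N.card ≤ N.card + R.card - 1)
  have h1 : ∑ x ∈ N ∪ R, f x / ∏ y ∈ (N ∪ R).erase x, (x - y) =
      ∑ x ∈ N ∪ R, (f x - p.eval x) / ∏ y ∈ (N ∪ R).erase x, (x - y) := by
    simp only [sub_div, Finset.sum_sub_distrib, hz, sub_zero]
  rw [h1, Finset.sum_union hNR, Finset.sum_eq_zero (s := N) fun x hx => by simp [hpN x hx],
    zero_add]
  refine Finset.sum_congr rfl fun x hx => ?_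
  have hxN : x ∉ N := Finset.disjoint_right.mp hNR hx
  rw [Finset.erase_union_distrib, Finset.erase_eq_of_notMem hxN, Finset.prod_union]
  exact hNR.mono_right (Finset.erase_subset _ _)

/-- The symmetric node set `{s 0, -s 0, …, s (m - 1), -s (m - 1)}`. -/
noncomputable def symNodes (s : ℕ → ℝ) : ℕ → Finset ℝ
  | 0 => ∅
  | m + 1 => insert (s m) (insert (-s m) (symNodes s m))

/-- The polynomial of degree `< 2 * m` interpolating `f` at `symNodes s m`, in Newton form. -/
noncomputable def symNewton (f : ℝ → ℝ) (s : ℕ → ℝ) : ℕ → ℝ[X]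
  | 0 => 0
  | m + 1 =>
    let g := fun x => (f x - (symNewton f s m).eval x) / ∏ k ∈ Finset.range m, (x ^ 2 - s k ^ 2)
    symNewton f s m + (∏ k ∈ Finset.range m, (X ^ 2 - C (s k ^ 2))) *
      (C ((g (s m) + g (-s m)) / 2) + C ((g (s m) - g (-s m)) / (2 * s m)) * X)

/-- The quotient of the interpolation error of `symNewton f s m` by the nodal polynomial. -/
noncomputable def symQuot (f : ℝ → ℝ) (s : ℕ → ℝ) (m : ℕ) (x : ℝ) : ℝ :=
  (f x - (symNewton f s m).eval x) / ∏ k ∈ Finset.range m, (x ^ 2 - s k ^ 2)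

lemma mem_symNodes {s : ℕ → ℝ} {m : ℕ} {x : ℝ} :
    x ∈ symNodes s m ↔ ∃ k < m, x = s k ∨ x = -s k := by
  induction m with
  | zero => simp [symNodes]
  | succ m ih =>
    simp only [symNodes, Finset.mem_insert, ih, Nat.lt_succ_iff_lt_or_eq]
    constructor
    · rintro (h | h | ⟨k, hk, h⟩)
      · exact ⟨m, Or.inr rfl, Or.inl h⟩
      · exact ⟨m, Or.inr rfl, Or.inr h⟩
      · exact ⟨k, Or.inl hk, h⟩
    · rintro ⟨k, hk | rfl, h⟩
      · exact Or.inr (Or.inr ⟨k, hk, h⟩)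
      · tauto

variable {f : ℝ → ℝ} {s : ℕ → ℝ}

lemma symNodes_notMem (hs : ∀ m, 0 < s m) (hinj : Function.Injective s) (m : ℕ) :
    s m ∉ symNodes s m ∧ -s m ∉ symNodes s m := by
  have h0 := hs m
  constructor <;>
  · rw [mem_symNodes]
    rintro ⟨k, hk, h | h⟩
    all_goals
      have hk0 := hs k
      first
        | linarith
        | exact hk.ne' (hinj (by linarith))

lemma card_symNodes (hs : ∀ m, 0 < s m) (hinj : Function.Injective s) (m : ℕ) :
    (symNodes s m).card = 2 * m := by
  induction m with
  | zero => rfl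
  | succ m ih =>
    obtain ⟨h1, h2⟩ := symNodes_notMem hs hinj m
    have h0 := hs m
    rw [symNodes, Finset.card_insert_of_notMem, Finset.card_insert_of_notMem h2, ih]
    · ring
    · rw [Finset.mem_insert, not_or]
      exact ⟨by linarith, h1⟩

lemma prod_symNodes (hs : ∀ m, 0 < s m) (hinj : Function.Injective s) (m : ℕ) (x : ℝ) :
    ∏ y ∈ symNodes s m, (x - y) = ∏ k ∈ Finset.range m, (x ^ 2 - s k ^ 2) := by
  induction m with
  | zero => rfl
  | succ m ih =>
    obtain ⟨h1, h2⟩ := symNodes_notMem hs hinj m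
    have h0 := hs m
    rw [symNodes, Finset.prod_insert, Finset.prod_insert h2, ih, Finset.prod_range_succ]
    · ring
    · rw [Finset.mem_insert, not_or]
      exact ⟨by linarith, h1⟩

lemma prod_sq_sub_sq_ne_zero (hs : ∀ m, 0 < s m) (hinj : Function.Injective s) {m : ℕ} {x : ℝ}
    (hx : x ∉ symNodes s m) : ∏ k ∈ Finset.range m, (x ^ 2 - s k ^ 2) ≠ 0 := by
  rw [← prod_symNodes hs hinj, Finset.prod_ne_zero_iff]
  exact fun y hy h => hx (by rwa [sub_eq_zero.mp h])

lemma symNewton_succ_eval (m : ℕ) (x : ℝ) :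
    (symNewton f s (m + 1)).eval x = (symNewton f s m).eval x +
      (∏ k ∈ Finset.range m, (x ^ 2 - s k ^ 2)) * ((symQuot f s m (s m) + symQuot f s m (-s m)) / 2
        + (symQuot f s m (s m) - symQuot f s m (-s m)) / (2 * s m) * x) := by
  rw [symNewton]
  simp [eval_prod, symQuot]

lemma degree_symNewton_lt (m : ℕ) : (symNewton f s m).degree < (2 * m : ℕ) := by
  induction m with
  | zero => simp [symNewton]
  | succ m ih =>
    rw [symNewton]
    refine lt_of_le_of_lt (degree_add_le _ _) (max_lt (ih.trans ?_) ?_)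
    · exact_mod_cast (by omega : 2 * m < 2 * (m + 1))
    · refine lt_of_le_of_lt (degree_mul_le _ _) ?_
      have h1 : (∏ k ∈ Finset.range m, (X ^ 2 - C (s k ^ 2))).degree ≤
          ((2 * m : ℕ) : WithBot ℕ) := by
        rw [degree_prod]
        refine (Finset.sum_le_sum fun k _ => (degree_X_pow_sub_C (by norm_num) _).le).trans ?_
        simp [mul_comm]
      have h2 : ∀ a b : ℝ, (C a + C b * X).degree ≤ ((1 : ℕ) : WithBot ℕ) := fun a b => by
        rw [add_comm]; exact degree_linear_le
      refine lt_of_le_of_lt (add_le_add h1 (h2 _ _)) ?_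
      exact_mod_cast (by omega : 2 * m + 1 < 2 * (m + 1))

lemma eval_symNewton_of_mem (hs : ∀ m, 0 < s m) (hinj : Function.Injective s) (m : ℕ) :
    ∀ x ∈ symNodes s m, f x = (symNewton f s m).eval x := by
  induction m with
  | zero => simp [symNodes]
  | succ m ih =>
    intro x hx
    obtain ⟨h1, h2⟩ := symNodes_notMem hs hinj m
    have h0 := (hs m).ne'
    rw [symNodes, Finset.mem_insert, Finset.mem_insert] at hx
    rw [symNewton_succ_eval]
    rcases hx with rfl | rfl | hx
    · have hq : (∏ k ∈ Finset.range m, (s m ^ 2 - s k ^ 2)) * symQuot f s m (s m) =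
          f (s m) - (symNewton f s m).eval (s m) :=
        mul_div_cancel₀ _ (prod_sq_sub_sq_ne_zero hs hinj h1)
      have : (symQuot f s m (s m) + symQuot f s m (-s m)) / 2
        + (symQuot f s m (s m) - symQuot f s m (-s m)) / (2 * s m) * s m =
          symQuot f s m (s m) := by field_simp; ring
      rw [this, hq]
      ring
    · have hq : (∏ k ∈ Finset.range m, ((-s m) ^ 2 - s k ^ 2)) * symQuot f s m (-s m) =
          f (-s m) - (symNewton f s m).eval (-s m) :=
        mul_div_cancel₀ _ (prod_sq_sub_sq_ne_zero hs hinj h2)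
      have : (symQuot f s m (s m) + symQuot f s m (-s m)) / 2
        + (symQuot f s m (s m) - symQuot f s m (-s m)) / (2 * s m) * -s m =
          symQuot f s m (-s m) := by field_simp; ring
      rw [this, hq]
      ring
    · rw [← ih x hx, ← prod_symNodes hs hinj, Finset.prod_eq_zero hx (sub_self x)]
      ring

namespace OperatorConvexOn

variable {I : Set ℝ}

lemma sum_symQuot_div_nonneg (hf : OperatorConvexOn f I) (hs : ∀ m, 0 < s m)
    (hinj : Function.Injective s) (hsI : ∀ m, s m ∈ I ∧ -s m ∈ I) {m k : ℕ} (hm : 0 < m + k)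
    {R : Finset ℝ} (hR : R.card = 2 * k + 1) (hRI : ∀ x ∈ R, x ∈ I)
    (hRN : ∀ x ∈ R, x ∉ symNodes s m) :
    0 ≤ ∑ x ∈ R, symQuot f s m x / ∏ y ∈ R.erase x, (x - y) := by
  have hd : Disjoint (symNodes s m) R := Finset.disjoint_right.mpr fun x hx => hRN x hx
  have hRne : R.Nonempty := Finset.card_pos.mp (by omega)
  have h := hf.sum_finset_sq_mul_div_prod_nonneg (n := m + k) (T := symNodes s m ∪ R)
    (by rw [Finset.card_union_of_disjoint hd, card_symNodes hs hinj, hR]; ring)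
    (fun x hx => by
      rcases Finset.mem_union.mp hx with hx | hx
      · obtain ⟨j, _, rfl | rfl⟩ := mem_symNodes.mp hx
        exacts [(hsI j).1, (hsI j).2]
      · exact hRI x hx)
    (q := 1) (lt_of_le_of_lt degree_one_le (by exact_mod_cast hm))
  simp only [eval_one, one_pow, one_mul] at h
  rw [sum_div_prod_erase_union hd hRne (p := symNewton f s m)
    (by rw [card_symNodes hs hinj]; exact degree_symNewton_lt m)
    (eval_symNewton_of_mem hs hinj m)] at h
  simpa only [prod_symNodes hs hinj, ← div_div, symQuot] using h

lemma symQuot_nonneg (hf : OperatorConvexOn f I) (hs : ∀ m, 0 < s m)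
    (hinj : Function.Injective s) (hsI : ∀ m, s m ∈ I ∧ -s m ∈ I) {m : ℕ} (hm : 0 < m) {x : ℝ}
    (hx : x ∈ I) (hxN : x ∉ symNodes s m) : 0 ≤ symQuot f s m x := by
  have h := hf.sum_symQuot_div_nonneg hs hinj hsI (m := m) (k := 0) hm (R := {x}) rfl
    (by simpa using hx) (by simpa using hxN)
  simpa using h

lemma symQuot_le_add (hf : OperatorConvexOn f I) (hs : ∀ m, 0 < s m)
    (hinj : Function.Injective s) (hsI : ∀ m, s m ∈ I ∧ -s m ∈ I) {m : ℕ} (hm : 0 < m)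
    {x r : ℝ} (hx : x ∈ I) (hr : r ∈ I) (hr' : -r ∈ I) (hxr : |x| < r)
    (hxN : x ∉ symNodes s m) (hsr : ∀ k, s k < r) :
    symQuot f s m x ≤ symQuot f s m r + symQuot f s m (-r) := by
  obtain ⟨hx1, hx2⟩ := abs_lt.mp hxr
  have hr0 : 0 < r := (abs_nonneg x).trans_lt hxr
  have hrN : r ∉ symNodes s m := by
    rw [mem_symNodes]
    rintro ⟨k, -, h | h⟩
    · exact (hsr k).ne' h
    · linarith [hs k]
  have hrN' : -r ∉ symNodes s m := by
    rw [mem_symNodes]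
    rintro ⟨k, -, h | h⟩
    · linarith [hs k]
    · linarith [hsr k]
  have n1 : x ≠ r := hx2.ne
  have n2 : x ≠ -r := hx1.ne'
  have n3 : r ≠ -r := by linarith
  have h := hf.sum_symQuot_div_nonneg hs hinj hsI (m := m) (k := 1) (by omega) (R := {x, r, -r})
    (Finset.card_eq_three.mpr ⟨x, r, -r, n1, n2, n3, rfl⟩)
    (by simp [hx, hr, hr']) (by simp [hxN, hrN, hrN'])
  have e1 : ({x, r, -r} : Finset ℝ).erase x = {r, -r} := by
    ext y; simp only [Finset.mem_erase, Finset.mem_insert, Finset.mem_singleton]; grind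
  have e2 : ({x, r, -r} : Finset ℝ).erase r = {x, -r} := by
    ext y; simp only [Finset.mem_erase, Finset.mem_insert, Finset.mem_singleton]; grind
  have e3 : ({x, r, -r} : Finset ℝ).erase (-r) = {x, r} := by
    ext y; simp only [Finset.mem_erase, Finset.mem_insert, Finset.mem_singleton]; grind
  rw [Finset.sum_insert (by simp [n1, n2]), Finset.sum_pair n3, e1, e2, e3, Finset.prod_pair n3,
    Finset.prod_pair n2, Finset.prod_pair n1] at h
  have hg1 := hf.symQuot_nonneg hs hinj hsI hm hr hrN
  have hg2 := hf.symQuot_nonneg hs hinj hsI hm hr' hrN'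
  set A := symQuot f s m x
  set B := symQuot f s m r
  set D := symQuot f s m (-r)
  have hp1 : 0 < r - x := by linarith
  have hp2 : 0 < r + x := by linarith
  have h' : 0 ≤ (r - x) * (r + x) * (A / ((x - r) * (x - -r)) + (B / ((r - x) * (r - -r)) +
      D / ((-r - x) * (-r - r)))) := by positivity
  have e : (r - x) * (r + x) * (A / ((x - r) * (x - -r)) + (B / ((r - x) * (r - -r)) +
      D / ((-r - x) * (-r - r)))) = -A + B * ((r + x) / (2 * r)) + D * ((r - x) / (2 * r)) := by
    have a1 : x - r ≠ 0 := by linarith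
    have a2 : x - -r ≠ 0 := by linarith
    have a3 : r - x ≠ 0 := by linarith
    have a4 : r - -r ≠ 0 := by linarith
    have a5 : -r - x ≠ 0 := by linarith
    have a6 : -r - r ≠ 0 := by linarith
    field_simp
    ring
  rw [e] at h'
  have l1 : (r + x) / (2 * r) ≤ 1 := by rw [div_le_one (by linarith)]; linarith
  have l2 : (r - x) / (2 * r) ≤ 1 := by rw [div_le_one (by linarith)]; linarith
  nlinarith [mul_le_mul_of_nonneg_left l1 hg1, mul_le_mul_of_nonneg_left l2 hg2]

lemma add_le_symNewton_eval_add (hf : OperatorConvexOn f I) (hs : ∀ m, 0 < s m)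
    (hinj : Function.Injective s) (hsI : ∀ m, s m ∈ I ∧ -s m ∈ I) {r : ℝ} (hsr : ∀ k, s k < r)
    {m : ℕ} (hm : 0 < m) :
    f (s 0) + f (-s 0) ≤ (symNewton f s m).eval r + (symNewton f s m).eval (-r) := by
  induction m, hm using Nat.le_induction with
  | base =>
    have e : ∀ x, (symNewton f s (0 + 1)).eval x =
        (f (s 0) + f (-s 0)) / 2 + (f (s 0) - f (-s 0)) / (2 * s 0) * x := fun x => by
      rw [symNewton_succ_eval]
      simp [symNewton, symQuot]
    rw [show Nat.succ 0 = 0 + 1 from rfl, e, e]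
    apply le_of_eq
    ring
  | succ m hm ih =>
    obtain ⟨h1, h2⟩ := symNodes_notMem hs hinj m
    have g1 := hf.symQuot_nonneg hs hinj hsI hm (hsI m).1 h1
    have g2 := hf.symQuot_nonneg hs hinj hsI hm (hsI m).2 h2
    have hP : 0 ≤ ∏ k ∈ Finset.range m, (r ^ 2 - s k ^ 2) :=
      Finset.prod_nonneg fun k _ => by nlinarith [hs k, hsr k]
    simp only [symNewton_succ_eval, neg_sq]
    nlinarith [mul_nonneg hP (add_nonneg g1 g2)]

lemma symQuot_mul_prod_le (hf : OperatorConvexOn f I) (hs : ∀ m, 0 < s m)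
    (hinj : Function.Injective s) (hsI : ∀ m, s m ∈ I ∧ -s m ∈ I) {m : ℕ} (hm : 0 < m)
    {x r : ℝ} (hx : x ∈ I) (hr : r ∈ I) (hr' : -r ∈ I) (hxr : |x| < r)
    (hxN : x ∉ symNodes s m) (hsr : ∀ k, s k < r) :
    symQuot f s m x * ∏ k ∈ Finset.range m, (r ^ 2 - s k ^ 2) ≤
      f r + f (-r) - (f (s 0) + f (-s 0)) := by
  have hP : 0 < ∏ k ∈ Finset.range m, (r ^ 2 - s k ^ 2) :=
    Finset.prod_pos fun k _ => by nlinarith [hs k, hsr k]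
  have h1 := hf.symQuot_le_add hs hinj hsI hm hx hr hr' hxr hxN hsr
  have h2 := hf.add_le_symNewton_eval_add hs hinj hsI hsr hm
  have e1 : symQuot f s m r * ∏ k ∈ Finset.range m, (r ^ 2 - s k ^ 2) =
      f r - (symNewton f s m).eval r := div_mul_cancel₀ _ hP.ne'
  have e2 : symQuot f s m (-r) * ∏ k ∈ Finset.range m, (r ^ 2 - s k ^ 2) =
      f (-r) - (symNewton f s m).eval (-r) := by
    rw [symQuot, neg_sq, div_mul_cancel₀ _ hP.ne']
  nlinarith [mul_le_mul_of_nonneg_right h1 hP.le]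

/-- An operator convex function on `(-1, 1)` is the sum of a power series on every smaller
symmetric interval. -/
theorem exists_hasSum_pow {f : ℝ → ℝ} (hf : OperatorConvexOn f (Set.Ioo (-1) 1)) {ρ : ℝ}
    (hρ0 : 0 < ρ) (hρ1 : ρ < 1) :
    ∃ a : ℕ → ℝ, ∀ x : ℝ, |x| < ρ → HasSum (fun n => a n * x ^ n) (f x) := by
  obtain ⟨r, hρr, hr1⟩ := exists_between hρ1
  set δ := (r - ρ) / 2 with hδ
  have hδ0 : 0 < δ := by rw [hδ]; linarith
  have hδr : δ < r := by rw [hδ]; linarith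
  set s : ℕ → ℝ := fun m => δ / 2 * (1 + 1 / ((m : ℝ) + 1)) with hsdef
  have hs2 : ∀ m, δ / 2 ≤ s m := fun m => by
    have : (0 : ℝ) < 1 / ((m : ℝ) + 1) := Nat.one_div_pos_of_nat
    simp only [hsdef]
    nlinarith
  have hsδ : ∀ m, s m ≤ δ := fun m => by
    have : 1 / ((m : ℝ) + 1) ≤ 1 := by
      rw [div_le_one (by positivity)]
      linarith [Nat.cast_nonneg (α := ℝ) m]
    simp only [hsdef]
    nlinarith
  have hs : ∀ m, 0 < s m := fun m => by linarith [hs2 m]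
  have hinj : Function.Injective s := by
    intro a b hab
    have h1 : (1 : ℝ) / ((a : ℝ) + 1) = 1 / ((b : ℝ) + 1) := by
      have := mul_left_cancel₀ (by positivity : δ / 2 ≠ 0) hab
      linarith
    have h2 := inv_injective (by simpa only [one_div] using h1)
    exact_mod_cast add_right_cancel h2
  have hsr : ∀ m, s m < r := fun m => (hsδ m).trans_lt hδr
  have hsI : ∀ m, s m ∈ Set.Ioo (-1 : ℝ) 1 ∧ -s m ∈ Set.Ioo (-1 : ℝ) 1 := fun m => by
    have h1 := hs m
    have h2 := hsr m
    exact ⟨⟨by linarith, by linarith⟩, ⟨by linarith, by linarith⟩⟩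
  have hrI : r ∈ Set.Ioo (-1 : ℝ) 1 := ⟨by linarith, hr1⟩
  have hrI' : -r ∈ Set.Ioo (-1 : ℝ) 1 := ⟨by linarith, by linarith⟩
  set K := f r + f (-r) - (f (s 0) + f (-s 0)) with hK
  set R := r ^ 2 - δ ^ 2 with hR
  have hR0 : 0 < R := by rw [hR]; nlinarith
  have hgap : ρ ^ 2 + δ ^ 2 < R := by rw [hR, hδ]; nlinarith
  have hg : ∀ m, 0 < m → ∀ x, |x| < r → x ∉ symNodes s m →
      0 ≤ symQuot f s m x ∧ symQuot f s m x ≤ K / R ^ m := by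
    intro m hm x hx hxN
    have hxI : x ∈ Set.Ioo (-1 : ℝ) 1 := by
      obtain ⟨h1, h2⟩ := abs_lt.mp hx
      exact ⟨by linarith, by linarith⟩
    have h0 := hf.symQuot_nonneg hs hinj hsI hm hxI hxN
    have h1 := hf.symQuot_mul_prod_le hs hinj hsI hm hxI hrI hrI' hx hxN hsr
    refine ⟨h0, ?_⟩
    rw [le_div_iff₀ (by positivity)]
    refine (mul_le_mul_of_nonneg_left ?_ h0).trans h1
    calc R ^ m = ∏ _k ∈ Finset.range m, R := by simp
      _ ≤ _ := Finset.prod_le_prod (fun _ _ => hR0.le) fun k _ => by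
        rw [hR]; nlinarith [hsδ k, hs k]
  have hs_abs : ∀ m, |s m| < r ∧ |-s m| < r := fun m => by
    rw [abs_neg, abs_of_pos (hs m)]
    exact ⟨hsr m, hsr m⟩
  have hK0 : 0 ≤ K := by
    obtain ⟨h1, h2⟩ := hg 1 one_pos (s 1) (hs_abs 1).1 (symNodes_notMem hs hinj 1).1
    have := h1.trans h2
    rw [pow_one] at this
    by_contra hneg
    linarith [div_neg_of_neg_of_pos (not_le.mp hneg) hR0]
  set α : ℕ → ℝ := fun m => (symQuot f s m (s m) + symQuot f s m (-s m)) / 2 with hα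
  set β : ℕ → ℝ := fun m => (symQuot f s m (s m) - symQuot f s m (-s m)) / (2 * s m) with hβ
  have hαβ : ∀ m, 0 < m → |α m| + |β m| ≤ (K + K / δ) / R ^ m := by
    intro m hm
    obtain ⟨h1, h2⟩ := hg m hm _ (hs_abs m).1 (symNodes_notMem hs hinj m).1
    obtain ⟨h3, h4⟩ := hg m hm _ (hs_abs m).2 (symNodes_notMem hs hinj m).2
    have ha : |α m| ≤ K / R ^ m := by
      rw [abs_le]
      constructor <;> simp only [hα] <;> linarith
    have hb : |β m| ≤ K / R ^ m / δ := by
      simp only [hβ, abs_div]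
      refine div_le_div₀ (h1.trans h2) ?_ hδ0 ?_
      · rw [abs_le]; constructor <;> linarith
      · rw [abs_of_pos (by linarith [hs m])]; linarith [hs2 m]
    calc |α m| + |β m| ≤ K / R ^ m + K / R ^ m / δ := add_le_add ha hb
      _ = _ := by field_simp
  set F : ℕ → ℂ → ℂ := fun m z =>
    (∏ k ∈ Finset.range m, (z ^ 2 - (s k : ℂ) ^ 2)) * ((α m : ℂ) + (β m : ℂ) * z) with hF
  set L := K + K / δ + (|α 0| + |β 0|) with hL
  have hL0 : ∀ m, |α m| + |β m| ≤ L / R ^ m := by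
    intro m
    have hKδ : 0 ≤ K / δ := by positivity
    rcases Nat.eq_zero_or_pos m with rfl | hm
    · rw [pow_zero, div_one, hL]; linarith
    · refine (hαβ m hm).trans ?_
      gcongr
      rw [hL]
      linarith [abs_nonneg (α 0), abs_nonneg (β 0)]
  set θ := (ρ ^ 2 + δ ^ 2) / R with hθ
  have hθ0 : 0 ≤ θ := by positivity
  have hθ1 : θ < 1 := by rw [hθ, div_lt_one hR0]; exact hgap
  have hFle : ∀ m, ∀ z ∈ Metric.ball (0 : ℂ) ρ, ‖F m z‖ ≤ L * θ ^ m := by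
    intro m z hz
    have hz' : ‖z‖ ≤ ρ := by simpa using (mem_ball_zero_iff.mp hz).le
    have h1 : ‖∏ k ∈ Finset.range m, (z ^ 2 - (s k : ℂ) ^ 2)‖ ≤ (ρ ^ 2 + δ ^ 2) ^ m := by
      rw [norm_prod]
      calc _ ≤ ∏ _k ∈ Finset.range m, (ρ ^ 2 + δ ^ 2) := by
            refine Finset.prod_le_prod (fun _ _ => norm_nonneg _) fun k _ => ?_
            refine (norm_sub_le _ _).trans (add_le_add ?_ ?_)
            · rw [norm_pow]; gcongr
            · rw [norm_pow, Complex.norm_real, Real.norm_of_nonneg (hs k).le]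
              exact pow_le_pow_left₀ (hs k).le (hsδ k) 2
        _ = _ := by simp
    have h2 : ‖(α m : ℂ) + (β m : ℂ) * z‖ ≤ L / R ^ m := by
      refine le_trans ?_ (hL0 m)
      refine (norm_add_le _ _).trans (add_le_add (by simp) ?_)
      rw [norm_mul, Complex.norm_real, Real.norm_eq_abs]
      exact mul_le_of_le_one_right (abs_nonneg _) (by linarith)
    calc ‖F m z‖ ≤ (ρ ^ 2 + δ ^ 2) ^ m * (L / R ^ m) := by
          simp only [hF, norm_mul]
          exact mul_le_mul h1 h2 (norm_nonneg _) (by positivity)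
      _ = L * θ ^ m := by rw [hθ, div_pow (ρ ^ 2 + δ ^ 2) R, mul_div_left_comm]
  have hsum : Summable fun m => L * θ ^ m :=
    (summable_geometric_of_lt_one hθ0 hθ1).mul_left L
  have hdiff : DifferentiableOn ℂ (fun z => ∑' m, F m z) (Metric.ball 0 ρ) := by
    refine Complex.differentiableOn_tsum_of_summable_norm hsum (fun m => ?_) Metric.isOpen_ball hFle
    simp only [hF]
    fun_prop
  have hpartial : ∀ M (x : ℝ), ∑ m ∈ Finset.range M, F m (x : ℂ) =
      (((symNewton f s M).eval x : ℝ) : ℂ) := by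
    intro M x
    induction M with
    | zero => simp [symNewton]
    | succ M ih =>
      rw [Finset.sum_range_succ, ih, symNewton_succ_eval]
      simp only [hF, hα, hβ]
      push_cast
      ring
  have hval : ∀ x : ℝ, |x| < ρ → ∑' m, F m (x : ℂ) = (f x : ℂ) := by
    intro x hx
    have hxb : (x : ℂ) ∈ Metric.ball (0 : ℂ) ρ := by simpa using hx
    have hsumm : Summable fun m => F m (x : ℂ) :=
      Summable.of_norm_bounded hsum fun m => hFle m _ hxb
    refine tendsto_nhds_unique hsumm.hasSum.tendsto_sum_nat ?_
    simp only [hpartial]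
    refine (Complex.continuous_ofReal.tendsto _).comp ?_
    rw [tendsto_iff_norm_sub_tendsto_zero]
    have hb : Filter.Tendsto (fun m => K * θ ^ m) Filter.atTop (nhds 0) := by
      simpa using (tendsto_pow_atTop_nhds_zero_of_lt_one hθ0 hθ1).const_mul K
    refine squeeze_zero' (Filter.Eventually.of_forall fun _ => norm_nonneg _) ?_ hb
    filter_upwards [Filter.eventually_gt_atTop 0] with m hm
    rw [norm_sub_rev, Real.norm_eq_abs]
    by_cases hxN : x ∈ symNodes s m
    · rw [eval_symNewton_of_mem (f := f) hs hinj m x hxN, sub_self, abs_zero]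
      positivity
    · obtain ⟨h1, h2⟩ := hg m hm x (hx.trans hρr) hxN
      have e : f x - (symNewton f s m).eval x =
          symQuot f s m x * ∏ k ∈ Finset.range m, (x ^ 2 - s k ^ 2) :=
        (div_mul_cancel₀ _ (prod_sq_sub_sq_ne_zero hs hinj hxN)).symm
      rw [e, abs_mul, abs_of_nonneg h1, Finset.abs_prod]
      have h3 : ∏ k ∈ Finset.range m, |x ^ 2 - s k ^ 2| ≤ (ρ ^ 2 + δ ^ 2) ^ m := by
        calc _ ≤ ∏ _k ∈ Finset.range m, (ρ ^ 2 + δ ^ 2) := by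
              refine Finset.prod_le_prod (fun _ _ => abs_nonneg _) fun k _ => ?_
              have hx2 : x ^ 2 ≤ ρ ^ 2 := sq_le_sq' (by linarith [neg_abs_le x])
                (by linarith [le_abs_self x])
              have hs2 : s k ^ 2 ≤ δ ^ 2 := pow_le_pow_left₀ (hs k).le (hsδ k) 2
              rw [abs_le]
              constructor <;> nlinarith [sq_nonneg x, sq_nonneg (s k)]
          _ = _ := by simp
      calc _ ≤ K / R ^ m * (ρ ^ 2 + δ ^ 2) ^ m :=
            mul_le_mul h2 h3 (Finset.prod_nonneg fun _ _ => abs_nonneg _) (by positivity)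
        _ = K * θ ^ m := by rw [hθ, div_pow (ρ ^ 2 + δ ^ 2) R, div_mul_eq_mul_div, mul_div_assoc]
  refine ⟨fun n => ((n.factorial : ℂ)⁻¹ * iteratedDeriv n (fun z => ∑' m, F m z) 0).re,
    fun x hx => ?_⟩
  have hxb : (x : ℂ) ∈ Metric.ball (0 : ℂ) ρ := by simpa using hx
  have h := Complex.hasSum_re (Complex.hasSum_taylorSeries_on_ball hdiff hxb)
  simp only [hval x hx, Complex.ofReal_re] at h
  convert h using 2 with n
  rw [sub_zero, smul_eq_mul, smul_eq_mul, ← Complex.ofReal_pow, mul_left_comm,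
    Complex.re_ofReal_mul, mul_comm]

end OperatorConvexOn

end SymmetricNewton

section HankelForm

open Polynomial Lagrange Asymptotics Filter Topology

namespace OperatorConvexOn

lemma coeff_nonneg_of_isBigO {g : ℝ → ℝ} {I : Set ℝ} (hg : OperatorConvexOn g I)
    (hI : I ∈ 𝓝 (0 : ℝ)) {n : ℕ} {q P : ℝ[X]} (hq : q.degree < n)
    (h : (fun x => q.eval x ^ 2 * g x - P.eval x) =O[𝓝 0] fun x => x ^ (2 * n + 1)) :
    0 ≤ P.coeff (2 * n) := by
  set Q := P %ₘ X ^ (2 * n + 1) with hQ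
  have hPQ : Q + X ^ (2 * n + 1) * (P /ₘ X ^ (2 * n + 1)) = P := modByMonic_add_div P _
  have hQd : Q.degree < (2 * n + 1 : ℕ) := by
    have := degree_modByMonic_lt P (monic_X_pow (R := ℝ) (2 * n + 1))
    rwa [degree_X_pow] at this
  have hcoeff : P.coeff (2 * n) = Q.coeff (2 * n) := by
    conv_lhs => rw [← hPQ]
    rw [coeff_add, coeff_X_pow_mul']
    simp
  have hO : (fun x => q.eval x ^ 2 * g x - Q.eval x) =O[𝓝 0] fun x => x ^ (2 * n + 1) := by
    have h1 : (fun x : ℝ => x ^ (2 * n + 1) * (P /ₘ X ^ (2 * n + 1)).eval x) =O[𝓝 0]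
        fun x => x ^ (2 * n + 1) * (1 : ℝ) :=
      (isBigO_refl _ _).mul (((P /ₘ X ^ (2 * n + 1)).continuous.tendsto 0).isBigO_one ℝ)
    simp only [mul_one] at h1
    refine (h.add h1).congr_left fun x => ?_
    conv_lhs => rw [← hPQ]
    rw [eval_add, eval_mul, eval_pow, eval_X, hPQ]
    ring
  obtain ⟨M, hM⟩ := hO.bound
  set w : Fin (2 * n + 1) → ℝ := fun i => ∏ j ∈ Finset.univ.erase i, ((i : ℝ) - (j : ℝ)) with hw
  set K := ∑ i : Fin (2 * n + 1), |M| * ((i : ℕ) : ℝ) ^ (2 * n + 1) / |w i| with hK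
  have hlim : Tendsto (fun ε : ℝ => Q.coeff (2 * n) + ε * K) (𝓝[>] 0) (𝓝 (Q.coeff (2 * n))) := by
    have : Tendsto (fun ε : ℝ => Q.coeff (2 * n) + ε * K) (𝓝 0) (𝓝 (Q.coeff (2 * n) + 0 * K)) :=
      (continuous_const.add (continuous_id.mul continuous_const)).tendsto 0
    simpa using this.mono_left nhdsWithin_le_nhds
  rw [hcoeff]
  refine ge_of_tendsto hlim ?_
  have hev : ∀ᶠ ε : ℝ in 𝓝[>] 0, ∀ i : Fin (2 * n + 1), ε * (i : ℝ) ∈ I ∧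
      ‖q.eval (ε * (i : ℝ)) ^ 2 * g (ε * (i : ℝ)) - Q.eval (ε * (i : ℝ))‖ ≤
        M * ‖(ε * (i : ℝ)) ^ (2 * n + 1)‖ := by
    rw [eventually_all]
    intro i
    have ht : Tendsto (fun ε : ℝ => ε * (i : ℝ)) (𝓝[>] 0) (𝓝 0) := by
      have : Tendsto (fun ε : ℝ => ε * (i : ℝ)) (𝓝 0) (𝓝 (0 * (i : ℝ))) :=
        (continuous_id.mul continuous_const).tendsto 0
      rw [zero_mul] at this
      exact this.mono_left nhdsWithin_le_nhds
    exact ht.eventually ((eventually_mem_set.mpr hI).and hM)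
  filter_upwards [hev, self_mem_nhdsWithin] with ε hε hε0
  rw [Set.mem_Ioi] at hε0
  set t : Fin (2 * n + 1) → ℝ := fun i => ε * (i : ℝ) with ht
  have htm : StrictMono t := fun i j hij => by
    have : (i : ℝ) < (j : ℝ) := by exact_mod_cast hij
    exact mul_lt_mul_of_pos_left this hε0
  have hprod : ∀ i, ∏ j ∈ Finset.univ.erase i, (t i - t j) = ε ^ (2 * n) * w i := by
    intro i
    simp only [ht, ← mul_sub, hw, Finset.prod_mul_distrib, Finset.prod_const]
    simp
  have h0 := hg.sum_sq_mul_div_prod_nonneg htm (fun i => (hε i).1) hq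
  have hc := coeff_eq_sum (s := Finset.univ) (v := t) htm.injective.injOn
    (P := Q) (by simpa using hQd)
  simp only [Finset.card_univ, Fintype.card_fin, Nat.add_sub_cancel] at hc
  have hterm : ∀ i, (q.eval (t i) ^ 2 * g (t i) - Q.eval (t i)) /
      (∏ j ∈ Finset.univ.erase i, (t i - t j)) ≤
        ε * (|M| * ((i : ℕ) : ℝ) ^ (2 * n + 1) / |w i|) := by
    intro i
    refine (le_abs_self _).trans ?_
    rw [hprod, abs_div, abs_mul, abs_of_pos (pow_pos hε0 _)]
    have hb := (hε i).2
    rw [Real.norm_eq_abs, norm_pow, Real.norm_of_nonneg (by positivity)] at hb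
    have hb' := hb.trans (mul_le_mul_of_nonneg_right (le_abs_self M) (by positivity))
    refine (div_le_div_of_nonneg_right hb' (by positivity)).trans (le_of_eq ?_)
    rw [mul_pow, pow_succ ε]
    rcases eq_or_ne |w i| 0 with h | h
    · simp [h]
    · field_simp
  have hsum := Finset.sum_le_sum fun i (_ : i ∈ Finset.univ) => hterm i
  rw [← Finset.mul_sum, ← hK] at hsum
  simp only [sub_div, Finset.sum_sub_distrib] at hsum
  rw [← hc] at hsum
  linarith

end OperatorConvexOn

lemma exists_abs_coeff_mul_pow_le {a : ℕ → ℝ} {r : ℝ} (h : Summable fun n => a n * r ^ n) :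
    ∃ K, ∀ n, |a n * r ^ n| ≤ K := by
  obtain ⟨K, hK⟩ := h.tendsto_atTop_zero.abs.bddAbove_range
  exact ⟨K, fun n => hK ⟨n, rfl⟩⟩

lemma isBigO_sub_sum_range_pow {f : ℝ → ℝ} {a : ℕ → ℝ} {ρ : ℝ} (hρ : 0 < ρ)
    (ha : ∀ x : ℝ, |x| < ρ → HasSum (fun n => a n * x ^ n) (f x)) (N : ℕ) :
    (fun x => f x - ∑ m ∈ Finset.range N, a m * x ^ m) =O[𝓝 0] fun x => x ^ N := by
  set r := ρ / 2 with hr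
  have hr0 : 0 < r := by positivity
  obtain ⟨K, hK⟩ := exists_abs_coeff_mul_pow_le
    (ha r (by rw [abs_of_pos hr0, hr]; linarith)).summable
  refine IsBigO.of_bound (K / r ^ N * 2) ?_
  have hnear : ∀ᶠ x : ℝ in 𝓝 0, |x| < r / 2 := by
    have := Metric.ball_mem_nhds (0 : ℝ) (half_pos hr0)
    filter_upwards [this] with x hx
    simpa using hx
  filter_upwards [hnear] with x hx
  have h1 := (hasSum_nat_add_iff' N).mpr (ha x (by rw [hr] at hx; linarith))
  have hgeo : HasSum (fun m : ℕ => K / r ^ N * |x| ^ N * (1 / 2) ^ m) (K / r ^ N * |x| ^ N * 2) :=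
    hasSum_geometric_two.mul_left _
  rw [← h1.tsum_eq]
  have : K / r ^ N * 2 * ‖x ^ N‖ = K / r ^ N * |x| ^ N * 2 := by
    rw [norm_pow, Real.norm_eq_abs]; ring
  rw [this]
  refine tsum_of_norm_bounded hgeo fun m => ?_
  have hb : |a (m + N)| ≤ K / r ^ (m + N) := by
    rw [le_div_iff₀ (by positivity)]
    have := hK (m + N)
    rwa [abs_mul, abs_pow, abs_of_pos hr0] at this
  have hK0 : 0 ≤ K := (abs_nonneg _).trans (hK 0)
  rw [Real.norm_eq_abs, abs_mul, abs_pow]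
  calc |a (m + N)| * |x| ^ (m + N) ≤ K / r ^ (m + N) * ((r / 2) ^ m * |x| ^ N) := by
        rw [pow_add |x|]
        gcongr
    _ = _ := by rw [div_eq_mul_one_div r 2, mul_pow, pow_add]; field_simp

namespace OperatorConvexOn

/-- The shifted Hankel form of the Taylor coefficients of `f` at `0` is nonnegative if
`x ↦ f (x ^ 2)` is operator convex near `0`. -/
theorem hankel_nonneg {f : ℝ → ℝ} {I : Set ℝ}
    (hf : OperatorConvexOn (fun x => f (x ^ 2)) I) (hI : I ∈ 𝓝 (0 : ℝ)) {a : ℕ → ℝ} {ρ : ℝ}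
    (hρ : 0 < ρ) (ha : ∀ x : ℝ, |x| < ρ → HasSum (fun n => a n * x ^ n) (f x))
    (k : ℕ) (c : ℕ → ℝ) :
    0 ≤ ∑ i ∈ Finset.range (k + 1), ∑ j ∈ Finset.range (k + 1), c i * c j * a (i + j + 1) := by
  set q : ℝ[X] := ∑ i ∈ Finset.range (k + 1), C (c i) * X ^ (2 * (k - i)) with hq
  set G : ℝ[X] := ∑ m ∈ Finset.range (2 * k + 2), C (a m) * X ^ (2 * m) with hG
  have hqd : q.degree < (2 * k + 1 : ℕ) := by
    rw [hq]
    refine (degree_sum_le _ _).trans_lt ?_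
    rw [Finset.sup_lt_iff (WithBot.bot_lt_coe _)]
    intro i _
    refine (degree_C_mul_X_pow_le _ _).trans_lt ?_
    exact_mod_cast (by omega : 2 * (k - i) < 2 * k + 1)
  have hO : (fun x => q.eval x ^ 2 * f (x ^ 2) - (q ^ 2 * G).eval x) =O[𝓝 0]
      fun x => x ^ (2 * (2 * k + 1) + 1) := by
    have hsq : Tendsto (fun x : ℝ => x ^ 2) (𝓝 0) (𝓝 0) := by
      simpa using (continuous_pow 2).tendsto (0 : ℝ)
    have h1 := (isBigO_sub_sum_range_pow hρ ha (2 * k + 2)).comp_tendsto hsq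
    have h2 : (fun x => q.eval x ^ 2) =O[𝓝 0] fun _ => (1 : ℝ) :=
      ((q.continuous.pow 2).tendsto 0).isBigO_one ℝ
    have h3 := h2.mul h1
    have h4 : (fun x : ℝ => (1 : ℝ) * ((fun x => x ^ (2 * k + 2)) ∘ fun x => x ^ 2) x) =O[𝓝 0]
        fun x => x ^ (2 * (2 * k + 1) + 1) := by
      have : (fun x : ℝ => x ^ (2 * (2 * k + 1) + 1) * x) =O[𝓝 0]
          fun x => x ^ (2 * (2 * k + 1) + 1) * (1 : ℝ) :=
        (isBigO_refl _ _).mul ((continuous_id.tendsto (0 : ℝ)).isBigO_one ℝ)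
      refine (this.congr_left fun x => ?_).congr_right fun x => mul_one _
      simp only [Function.comp_apply]
      ring
    refine (h3.trans h4).congr_left fun x => ?_
    simp only [Function.comp_apply, hG, eval_mul, eval_pow, eval_finsetSum, eval_C, eval_X,
      ← pow_mul]
    ring
  have := hf.coeff_nonneg_of_isBigO hI hqd hO
  convert this using 1
  have hexp : q ^ 2 * G = ∑ i ∈ Finset.range (k + 1), ∑ j ∈ Finset.range (k + 1),
      ∑ m ∈ Finset.range (2 * k + 2),
        C (c i * c j * a m) * X ^ (2 * (k - i) + 2 * (k - j) + 2 * m) := by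
    rw [sq, hq, hG, Finset.sum_mul_sum, Finset.sum_mul]
    refine Finset.sum_congr rfl fun i _ => ?_
    rw [Finset.sum_mul]
    refine Finset.sum_congr rfl fun j _ => ?_
    rw [Finset.mul_sum]
    refine Finset.sum_congr rfl fun m _ => ?_
    rw [C_mul, C_mul, pow_add, pow_add]
    ring
  rw [hexp]
  simp only [finsetSum_coeff, coeff_C_mul, coeff_X_pow]
  refine Finset.sum_congr rfl fun i hi => Finset.sum_congr rfl fun j hj => ?_
  rw [Finset.mem_range] at hi hj
  rw [Finset.sum_eq_single (i + j + 1)]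
  · rw [if_pos (by omega), mul_one]
  · intro m _ hm
    rw [if_neg (by omega), mul_zero]
  · intro hm
    exact absurd (Finset.mem_range.mpr (by omega)) hm

end OperatorConvexOn

end HankelForm

section PowerSeriesMonotone

open Filter Topology

variable {𝔸 : Type*} [NormedRing 𝔸] [NormedAlgebra ℝ 𝔸]

lemma hasDerivAt_add_smul_pow_succ (A D : 𝔸) (n : ℕ) (τ : ℝ) :
    HasDerivAt (fun τ : ℝ => (A + τ • D) ^ (n + 1))
      (∑ p ∈ Finset.HasAntidiagonal.antidiagonal n, (A + τ • D) ^ p.1 * D * (A + τ • D) ^ p.2) τ := by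
  have h1 : HasDerivAt (fun τ : ℝ => A + τ • D) D τ := by
    simpa using ((hasDerivAt_id τ).smul_const D).const_add A
  induction n with
  | zero => simpa using h1
  | succ n ih =>
    have := h1.mul ih
    rw [Finset.Nat.sum_antidiagonal_succ]
    simp only [pow_succ' _ (n + 1)]
    refine this.congr_deriv ?_
    rw [Finset.mul_sum, pow_zero, one_mul]
    congr 1
    refine Finset.sum_congr rfl fun p _ => ?_
    rw [pow_succ']
    simp only [mul_assoc]

variable [NormOneClass 𝔸]

/-- If every square section of the double series formally giving the derivative of
`τ ↦ ∑ a n * ℓ ((A + τ • D) ^ n)` is nonnegative, then the sum at `τ = 0` is at most the sum at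
`τ = 1`. -/
lemma hasSum_pow_le_hasSum_pow (ℓ : 𝔸 →L[ℝ] ℝ) {A D : 𝔸} {a : ℕ → ℝ} {r : ℝ}
    (ha : Summable fun n => a n * r ^ n) (hA : ‖A‖ < r) (hB : ‖A + D‖ < r)
    (hpos : ∀ (τ : ℝ) (k : ℕ), 0 ≤ ∑ i ∈ Finset.range k, ∑ j ∈ Finset.range k,
      a (i + j + 1) * ℓ ((A + τ • D) ^ i * D * (A + τ • D) ^ j))
    {x y : ℝ} (hx : HasSum (fun n => a n * ℓ (A ^ n)) x)
    (hy : HasSum (fun n => a n * ℓ ((A + D) ^ n)) y) : x ≤ y := by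
  obtain ⟨s, hs, hsr⟩ := exists_between (max_lt hA hB)
  obtain ⟨hAs, hBs⟩ := max_lt_iff.mp hs
  have hs0 : 0 < s := (norm_nonneg _).trans_lt hAs
  have hr0 : 0 < r := hs0.trans hsr
  obtain ⟨K, hK⟩ := exists_abs_coeff_mul_pow_le ha
  have hK0 : 0 ≤ K := (abs_nonneg _).trans (hK 0)
  set q := s / r with hq
  have hq0 : 0 ≤ q := by positivity
  have hq1 : q < 1 := (div_lt_one hr0).mpr hsr
  set S : Set ℝ := {τ | ‖A + τ • D‖ < s} with hS
  have hSo : IsOpen S := isOpen_lt (by fun_prop) continuous_const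
  have hSc : Convex ℝ S := by
    intro τ hτ σ hσ b c hb hc hbc
    have e : A + (b • τ + c • σ) • D = b • (A + τ • D) + c • (A + σ • D) := by
      have : A = (b + c) • A := by rw [hbc, one_smul]
      conv_lhs => rw [this]
      simp only [smul_eq_mul, add_smul, smul_add, mul_smul]
      abel
    have h := (convex_ball (0 : 𝔸) s) (x := A + τ • D) (mem_ball_zero_iff.mpr hτ) (y := A + σ • D)
      (mem_ball_zero_iff.mpr hσ) hb hc hbc
    rw [← e] at h
    exact mem_ball_zero_iff.mp h
  have hS0 : (0 : ℝ) ∈ S := by simpa [hS] using hAs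
  have hS1 : (1 : ℝ) ∈ S := by simpa [hS] using hBs
  set H : ℝ → ℕ × ℕ → ℝ := fun τ p =>
    a (p.1 + p.2 + 1) * ℓ ((A + τ • D) ^ p.1 * D * (A + τ • D) ^ p.2) with hH
  set c := ‖ℓ‖ * ‖D‖ * (K / r) with hc
  have hHle : ∀ τ ∈ S, ∀ p, ‖H τ p‖ ≤ c * q ^ (p.1 + p.2) := by
    intro τ hτ p
    have h1 : ‖(A + τ • D) ^ p.1 * D * (A + τ • D) ^ p.2‖ ≤ s ^ p.1 * ‖D‖ * s ^ p.2 := by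
      have hp : ∀ i, ‖(A + τ • D) ^ i‖ ≤ s ^ i := fun i =>
        (norm_pow_le _ i).trans (pow_le_pow_left₀ (norm_nonneg _) (le_of_lt hτ) i)
      refine (norm_mul_le _ _).trans (mul_le_mul ((norm_mul_le _ _).trans ?_) (hp _)
        (norm_nonneg _) (by positivity))
      exact mul_le_mul_of_nonneg_right (hp _) (norm_nonneg _)
    have h2 : |a (p.1 + p.2 + 1)| ≤ K / r ^ (p.1 + p.2 + 1) := by
      rw [le_div_iff₀ (by positivity)]
      have := hK (p.1 + p.2 + 1)
      rwa [abs_mul, abs_pow, abs_of_pos hr0] at this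
    simp only [hH, norm_mul, Real.norm_eq_abs (a _)]
    calc _ ≤ K / r ^ (p.1 + p.2 + 1) * (‖ℓ‖ * (s ^ p.1 * ‖D‖ * s ^ p.2)) :=
          mul_le_mul h2 ((ℓ.le_opNorm _).trans (mul_le_mul_of_nonneg_left h1 (norm_nonneg _)))
            (norm_nonneg _) (by positivity)
      _ = c * (s / r) ^ (p.1 + p.2) := by
          rw [hc, div_pow, pow_succ r, pow_add s]
          field_simp
  have hHs : ∀ τ ∈ S, Summable (H τ) := by
    intro τ hτ
    have hg := summable_geometric_of_lt_one hq0 hq1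
    have h1 := (hg.mul_of_nonneg hg (fun _ => pow_nonneg hq0 _) fun _ => pow_nonneg hq0 _).mul_left c
    exact Summable.of_norm_bounded h1 fun p => by rw [← pow_add]; exact hHle τ hτ p
  set g : ℕ → ℝ → ℝ := fun n τ => a (n + 1) * ℓ ((A + τ • D) ^ (n + 1)) with hg
  set g' : ℕ → ℝ → ℝ := fun n τ => ∑ p ∈ Finset.HasAntidiagonal.antidiagonal n, H τ p with hg'
  have hgd : ∀ n τ, τ ∈ S → HasDerivAt (g n) (g' n τ) τ := by
    intro n τ _
    refine ((ℓ.hasFDerivAt.comp_hasDerivAt τ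
      (hasDerivAt_add_smul_pow_succ A D n τ)).const_mul (a (n + 1))).congr_deriv ?_
    rw [map_sum, Finset.mul_sum]
    refine Finset.sum_congr rfl fun p hp => ?_
    rw [hH, ← Finset.HasAntidiagonal.mem_antidiagonal.mp hp]
  have hu : Summable fun n : ℕ => c * (((n : ℝ) + 1) * q ^ n) := by
    have h1 := summable_pow_mul_geometric_of_norm_lt_one (R := ℝ) 1
      (r := q) (by rwa [Real.norm_of_nonneg hq0])
    refine ((h1.add (summable_geometric_of_lt_one hq0 hq1)).mul_left c).congr fun n => ?_
    rw [pow_one]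
    ring
  have hgb : ∀ n τ, τ ∈ S → ‖g' n τ‖ ≤ c * (((n : ℝ) + 1) * q ^ n) := by
    intro n τ hτ
    refine (norm_sum_le _ _).trans ?_
    calc _ ≤ ∑ p ∈ Finset.HasAntidiagonal.antidiagonal n, c * q ^ n := Finset.sum_le_sum fun p hp => by
          have := hHle τ hτ p
          rwa [Finset.HasAntidiagonal.mem_antidiagonal.mp hp] at this
      _ = _ := by
          rw [Finset.sum_const, Finset.Nat.card_antidiagonal, nsmul_eq_mul]
          push_cast
          ring
  have hx' : HasSum (fun n => g n 0) (x - a 0 * ℓ 1) := by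
    simpa [hg] using (hasSum_nat_add_iff' 1).mpr hx
  have hy' : HasSum (fun n => g n 1) (y - a 0 * ℓ 1) := by
    simpa [hg] using (hasSum_nat_add_iff' 1).mpr hy
  have hd : ∀ τ ∈ S, HasDerivAt (fun τ => ∑' n, g n τ) (∑' n, g' n τ) τ := fun τ hτ =>
    hasDerivAt_tsum_of_isPreconnected hu hSo hSc.isPreconnected hgd hgb hS0 hx'.summable hτ
  have hd0 : ∀ τ ∈ S, 0 ≤ ∑' n, g' n τ := by
    intro τ hτ
    have h1 : HasSum (fun n => g' n τ) (∑' p, H τ p) := by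
      have h2 := (Finset.HasAntidiagonal.sigmaAntidiagonalEquivProd (A := ℕ)).hasSum_iff.mpr (hHs τ hτ).hasSum
      refine h2.sigma fun n => ?_
      have := Finset.hasSum (Finset.HasAntidiagonal.antidiagonal n) (H τ)
      exact this
    rw [h1.tsum_eq]
    have hsq : Tendsto (fun k => Finset.range k ×ˢ Finset.range k) atTop
        (atTop : Filter (Finset (ℕ × ℕ))) := by
      refine tendsto_atTop_finset_of_monotone (fun a b hab => ?_) fun p => ?_
      · exact Finset.product_subset_product (Finset.range_mono hab) (Finset.range_mono hab)
      · refine ⟨p.1 + p.2 + 1, ?_⟩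
        simp only [Finset.mem_product, Finset.mem_range]
        omega
    refine ge_of_tendsto' ((hHs τ hτ).hasSum.comp hsq) fun k => ?_
    simp only [Function.comp_apply, Finset.sum_product]
    exact hpos τ k
  have hmono : MonotoneOn (fun τ => ∑' n, g n τ) S := by
    refine monotoneOn_of_deriv_nonneg hSc
      (fun τ hτ => (hd τ hτ).continuousAt.continuousWithinAt) ?_ ?_
    · rw [hSo.interior_eq]
      exact fun τ hτ => (hd τ hτ).differentiableAt.differentiableWithinAt
    · rw [hSo.interior_eq]
      exact fun τ hτ => by rw [(hd τ hτ).deriv]; exact hd0 τ hτ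
  have := hmono hS0 hS1 zero_le_one
  simp only [hx'.tsum_eq, hy'.tsum_eq] at this
  linarith

end PowerSeriesMonotone

section Loewner

open scoped Matrix.Norms.L2Operator MatrixOrder

variable {n : Type*} [Fintype n] [DecidableEq n]

lemma sum_mul_re_dotProduct_nonneg {C D : Matrix n n ℂ} (hC : C.IsHermitian)
    (hD : D.PosSemidef) (v : n → ℂ) {k : ℕ} {b : ℕ → ℕ → ℝ}
    (hb : ∀ c : ℕ → ℝ, 0 ≤ ∑ i ∈ Finset.range k, ∑ j ∈ Finset.range k, c i * c j * b i j) :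
    0 ≤ ∑ i ∈ Finset.range k, ∑ j ∈ Finset.range k,
      b i j * (star v ⬝ᵥ ((C ^ i * D * C ^ j) *ᵥ v)).re := by
  obtain ⟨M, rfl⟩ : ∃ M : Matrix n n ℂ, D = Mᴴ * M :=
    CStarAlgebra.nonneg_iff_eq_star_mul_self.mp hD.nonneg
  set w : ℕ → n → ℂ := fun i => M *ᵥ (C ^ i *ᵥ v) with hw
  have e : ∀ i j, (star v ⬝ᵥ ((C ^ i * (Mᴴ * M) * C ^ j) *ᵥ v)).re =
      ∑ l, ((w i l).re * (w j l).re + (w i l).im * (w j l).im) := by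
    intro i j
    have h1 : star v ⬝ᵥ ((C ^ i * (Mᴴ * M) * C ^ j) *ᵥ v) = star (w i) ⬝ᵥ w j := by
      rw [hw, star_mulVec, star_mulVec, (hC.pow i).eq, vecMul_vecMul, ← dotProduct_mulVec,
        mulVec_mulVec, mulVec_mulVec]
      simp only [mul_assoc]
    rw [h1, dotProduct, Complex.re_sum]
    refine Finset.sum_congr rfl fun l _ => ?_
    simp [Complex.mul_re]
  have h2 : ∑ i ∈ Finset.range k, ∑ j ∈ Finset.range k,
      b i j * (star v ⬝ᵥ ((C ^ i * (Mᴴ * M) * C ^ j) *ᵥ v)).re =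
      ∑ l, (∑ i ∈ Finset.range k, ∑ j ∈ Finset.range k, (w i l).re * (w j l).re * b i j +
        ∑ i ∈ Finset.range k, ∑ j ∈ Finset.range k, (w i l).im * (w j l).im * b i j) := by
    simp only [← Finset.sum_add_distrib]
    symm
    rw [Finset.sum_comm]
    refine Finset.sum_congr rfl fun i _ => ?_
    rw [Finset.sum_comm]
    refine Finset.sum_congr rfl fun j _ => ?_
    rw [e, Finset.mul_sum]
    exact Finset.sum_congr rfl fun l _ => by ring
  rw [h2]
  exact Finset.sum_nonneg fun l _ => add_nonneg (hb _) (hb _)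

namespace Matrix.IsHermitian

variable {A : Matrix n n ℂ}

lemma norm_eq_norm_eigenvalues (hA : A.IsHermitian) : ‖A‖ = ‖hA.eigenvalues‖ := by
  conv_lhs => rw [hA.eq_mul_diagonal_mul]
  rw [← Unitary.coe_star, CStarRing.norm_mul_coe_unitary, CStarRing.norm_coe_unitary_mul,
    l2_opNorm_diagonal]
  simp [Pi.norm_def]

lemma cfc_pow (hA : A.IsHermitian) (m : ℕ) : hA.cfc (fun x => x ^ m) = A ^ m := by
  rw [← hA.cfc_eq]
  exact cfc_pow_id A m hA.isSelfAdjoint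

lemma hasSum_re_dotProduct_pow (hA : A.IsHermitian) {f : ℝ → ℝ} {a : ℕ → ℝ}
    (ha : ∀ i, HasSum (fun m => a m * hA.eigenvalues i ^ m) (f (hA.eigenvalues i)))
    (v : n → ℂ) :
    HasSum (fun m => a m * (star v ⬝ᵥ (A ^ m *ᵥ v)).re) (star v ⬝ᵥ (hA.cfc f *ᵥ v)).re := by
  simp only [← hA.cfc_pow, dotProduct_cfc_mulVec, Complex.re_sum, Finset.mul_sum,
    Complex.re_ofReal_mul]
  simp only [← mul_assoc (a _)]
  exact hasSum_sum fun i _ => (ha i).mul_right _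

end Matrix.IsHermitian

/-- A function given near `0` by a power series whose shifted coefficients have nonnegative Hankel
forms is monotone on Hermitian matrices of small norm. -/
theorem posSemidef_cfc_sub_cfc [Nonempty n] {f : ℝ → ℝ} {a : ℕ → ℝ} {ρ : ℝ}
    (ha : ∀ x : ℝ, |x| < ρ → HasSum (fun m => a m * x ^ m) (f x))
    (hankel : ∀ (k : ℕ) (c : ℕ → ℝ),
      0 ≤ ∑ i ∈ Finset.range k, ∑ j ∈ Finset.range k, c i * c j * a (i + j + 1))
    {A B : Matrix n n ℂ} (hA : A.IsHermitian) (hB : B.IsHermitian) (hAρ : ‖A‖ < ρ)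
    (hBρ : ‖B‖ < ρ) (hAB : (B - A).PosSemidef) : (hB.cfc f - hA.cfc f).PosSemidef := by
  have hherm := (hB.isHermitian_cfc f).sub (hA.isHermitian_cfc f)
  refine PosSemidef.of_dotProduct_mulVec_nonneg hherm fun v => ?_
  rw [Complex.nonneg_iff]
  refine ⟨?_, (hherm.im_star_dotProduct_mulVec_self v).symm⟩
  rw [sub_mulVec, dotProduct_sub, Complex.sub_re, sub_nonneg]
  obtain ⟨r, hr, hrρ⟩ := exists_between (max_lt hAρ hBρ)
  obtain ⟨hAr, hBr⟩ := max_lt_iff.mp hr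
  have hr0 : 0 < r := (norm_nonneg _).trans_lt hAr
  have hpow : ∀ {C : Matrix n n ℂ} (hC : C.IsHermitian), ‖C‖ < r →
      HasSum (fun m => a m * (star v ⬝ᵥ (C ^ m *ᵥ v)).re) (star v ⬝ᵥ (hC.cfc f *ᵥ v)).re := by
    intro C hC hCr
    refine hC.hasSum_re_dotProduct_pow (fun i => ha _ ?_) v
    rw [hC.norm_eq_norm_eigenvalues] at hCr
    exact (norm_le_pi_norm hC.eigenvalues i).trans_lt (hCr.trans hrρ)
  set ℓ : Matrix n n ℂ →L[ℝ] ℝ := LinearMap.toContinuousLinearMap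
    { toFun := fun C => (star v ⬝ᵥ (C *ᵥ v)).re
      map_add' := fun C E => by rw [add_mulVec, dotProduct_add, Complex.add_re]
      map_smul' := fun x C => by
        rw [smul_mulVec, dotProduct_smul, Complex.smul_re, RingHom.id_apply] } with hℓ
  have hℓv : ∀ C, ℓ C = (star v ⬝ᵥ (C *ᵥ v)).re := fun C => rfl
  refine hasSum_pow_le_hasSum_pow ℓ (A := A) (D := B - A)
    (ha r (by rwa [abs_of_pos hr0])).summable hAr (by simpa using hBr) ?_ (hpow hA hAr)
    (by simpa [hℓv] using hpow hB hBr)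
  intro τ k
  have hC : (A + τ • (B - A)).IsHermitian := by
    rw [IsHermitian, conjTranspose_add, conjTranspose_smul, hA.eq, hAB.isHermitian.eq]
    simp
  exact sum_mul_re_dotProduct_nonneg hC hAB v (b := fun i j => a (i + j + 1)) (hankel k)

theorem OperatorConvexOn.operatorMonotoneOn {f : ℝ → ℝ}
    (h1 : OperatorConvexOn f (Set.Ioo (-1 : ℝ) 1))
    (h2 : OperatorConvexOn (fun x => f (x ^ 2)) (Set.Ioo (-1 : ℝ) 1)) :
    OperatorMonotoneOn f (Set.Ioo (-1 : ℝ) 1) := by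
  intro n hn A B hA hB hAI hBI hAB
  have : Nonempty (Fin n) := ⟨⟨0, hn⟩⟩
  have hnorm : ∀ {C : Matrix (Fin n) (Fin n) ℂ} (hC : C.IsHermitian),
      (∀ i, hC.eigenvalues i ∈ Set.Ioo (-1 : ℝ) 1) → ‖C‖ < 1 := by
    intro C hC hCI
    rw [hC.norm_eq_norm_eigenvalues, pi_norm_lt_iff one_pos]
    exact fun i => abs_lt.mpr (hCI i)
  obtain ⟨ρ, hρ, hρ1⟩ := exists_between (max_lt (hnorm hA hAI) (hnorm hB hBI))
  obtain ⟨hAρ, hBρ⟩ := max_lt_iff.mp hρ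
  have hρ0 : 0 < ρ := (norm_nonneg _).trans_lt hAρ
  obtain ⟨a, ha⟩ := h1.exists_hasSum_pow hρ0 hρ1
  have hI : Set.Ioo (-1 : ℝ) 1 ∈ nhds (0 : ℝ) := Ioo_mem_nhds (by norm_num) one_pos
  refine posSemidef_cfc_sub_cfc ha (fun k c => ?_) hA hB hAρ hBρ hAB
  cases k with
  | zero => simp
  | succ k => exact h2.hankel_nonneg hI hρ0 ha k c

end Loewner

/-- core of Remark 0.5: if `φ` and `x ↦ φ(x²)` are both operator convex on
`(−1,1)`, then `φ` is operator monotone on `(−1,1)`. -/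
theorem stmt8 (φ : ℝ → ℝ)
    (h1 : OperatorConvexOn φ (Set.Ioo (-1 : ℝ) 1))
    (h2 : OperatorConvexOn (fun x => φ (x ^ 2)) (Set.Ioo (-1 : ℝ) 1)) :
    OperatorMonotoneOn φ (Set.Ioo (-1 : ℝ) 1) := by
  exact h1.operatorMonotoneOn h2
end

section
/- Let I ⊆ ℝ be a nondegenerate interval and let φ be both operator monotone and operator convex on I. Let J ⊆ ℝ be a nondegenerate interval and let f be operator convex on J with f(J) ⊆ I. Then the composite φ∘f is operator convex on J. -/
open Matrix Set
open scoped ComplexOrder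

open scoped MatrixOrder in
/-- The matrices with spectrum in a fixed interval form a convex set. -/
theorem Matrix.IsHermitian.eigenvalues_convexCombination_mem {ι : Type*} [Fintype ι]
    [DecidableEq ι] {I : Set ℝ} (hI : Convex ℝ I) {t : ℝ} (ht : t ∈ Set.Icc (0 : ℝ) 1)
    {A B : Matrix ι ι ℂ} (hA : A.IsHermitian) (hB : B.IsHermitian)
    (hAB : ((t : ℂ) • A + ((1 : ℂ) - (t : ℂ)) • B).IsHermitian)
    (hAI : ∀ i, hA.eigenvalues i ∈ I) (hBI : ∀ i, hB.eigenvalues i ∈ I) (i : ι) :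
    hAB.eigenvalues i ∈ I := by
  have : Nonempty ι := ⟨i⟩
  have ht₀ : (0 : ℂ) ≤ t := by exact_mod_cast ht.1
  have ht₁ : (0 : ℂ) ≤ 1 - t := by exact_mod_cast sub_nonneg.2 ht.2
  have eigenvalues_mem_Icc {C : Matrix ι ι ℂ} (hC : C.IsHermitian) {m M : ℝ} :
      (∀ j, hC.eigenvalues j ∈ Set.Icc m M) ↔
        (C - algebraMap ℝ _ m).PosSemidef ∧ (algebraMap ℝ _ M - C).PosSemidef := by
    rw [← Matrix.le_iff, ← Matrix.le_iff, algebraMap_le_iff_le_spectrum hC,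
      le_algebraMap_iff_spectrum_le hC, hC.spectrum_real_eq_range_eigenvalues]
    simp [forall_and]
  have algebraMap_eq (r : ℝ) : algebraMap ℝ (Matrix ι ι ℂ) r =
      (t : ℂ) • algebraMap ℝ (Matrix ι ι ℂ) r +
        ((1 : ℂ) - (t : ℂ)) • algebraMap ℝ (Matrix ι ι ℂ) r := by
    module
  obtain ⟨a, ha⟩ := Finite.exists_min (Sum.elim hA.eigenvalues hB.eigenvalues)
  obtain ⟨b, hb⟩ := Finite.exists_max (Sum.elim hA.eigenvalues hB.eigenvalues)
  have hmem (k : ι ⊕ ι) : Sum.elim hA.eigenvalues hB.eigenvalues k ∈ I := by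
    cases k with
    | inl j => exact hAI j
    | inr j => exact hBI j
  refine hI.ordConnected.out (hmem a) (hmem b) ((eigenvalues_mem_Icc hAB).2 ?_ i)
  obtain ⟨hAm, hAM⟩ := (eigenvalues_mem_Icc hA).1 fun j ↦ ⟨ha (.inl j), hb (.inl j)⟩
  obtain ⟨hBm, hBM⟩ := (eigenvalues_mem_Icc hB).1 fun j ↦ ⟨ha (.inr j), hb (.inr j)⟩
  constructor
  · convert (hAm.smul ht₀).add (hBm.smul ht₁) using 1
    rw [algebraMap_eq]
    module
  · convert (hAM.smul ht₀).add (hBM.smul ht₁) using 1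
    rw [algebraMap_eq]
    module

theorem Matrix.IsHermitian.isHermitian_cfc_s9 {ι : Type*} [Fintype ι] [DecidableEq ι]
    {A : Matrix ι ι ℂ} (hA : A.IsHermitian) (f : ℝ → ℝ) : (hA.cfc f).IsHermitian := by
  rw [← hA.cfc_eq]
  exact cfc_predicate f A

theorem Matrix.IsHermitian.eigenvalues_cfc_mem_image {ι : Type*} [Fintype ι] [DecidableEq ι]
    {A : Matrix ι ι ℂ} (hA : A.IsHermitian) {f : ℝ → ℝ} {J : Set ℝ}
    (hJ : ∀ i, hA.eigenvalues i ∈ J) (h : (hA.cfc f).IsHermitian) (i : ι) :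
    h.eigenvalues i ∈ f '' J := by
  have hspec : spectrum ℝ (hA.cfc f) = f '' Set.range hA.eigenvalues := by
    rw [← hA.cfc_eq, ← hA.spectrum_real_eq_range_eigenvalues]
    exact cfc_map_spectrum f A hA (A.finite_real_spectrum.continuousOn f)
  exact Set.image_mono (Set.range_subset_iff.2 hJ) (hspec ▸ h.eigenvalues_mem_spectrum_real i)

theorem Matrix.IsHermitian.cfc_comp {ι : Type*} [Fintype ι] [DecidableEq ι]
    {A : Matrix ι ι ℂ} (hA : A.IsHermitian) (g f : ℝ → ℝ) (h : (hA.cfc f).IsHermitian) :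
    hA.cfc (g ∘ f) = h.cfc g := by
  rw [← h.cfc_eq, ← hA.cfc_eq, ← hA.cfc_eq]
  exact _root_.cfc_comp g f A hA ((A.finite_real_spectrum.image f).continuousOn g)
    (A.finite_real_spectrum.continuousOn f)

/-- if `φ` is operator monotone and operator convex on `I`, and `f` is operator
convex on `J` with `f(J) ⊆ I`, then `φ∘f` is operator convex on `J`. -/
theorem stmt9 (I : Set ℝ) (hI : Convex ℝ I) (hnt : I.Nontrivial)
    (φ : ℝ → ℝ) (hφm : OperatorMonotoneOn φ I) (hφc : OperatorConvexOn φ I)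
    (J : Set ℝ) (hJ : Convex ℝ J) (hJnt : J.Nontrivial)
    (f : ℝ → ℝ) (hf : OperatorConvexOn f J) (hfJ : f '' J ⊆ I) :
    OperatorConvexOn (φ ∘ f) J := by
  intro n hn t ht A B hA hB hAB hAJ hBJ
  have hABJ := hA.eigenvalues_convexCombination_mem hJ ht hB hAB hAJ hBJ
  have hfA := hA.isHermitian_cfc_s9 f
  have hfB := hB.isHermitian_cfc_s9 f
  have hfAB := hAB.isHermitian_cfc_s9 f
  have hfAI i := hfJ (hA.eigenvalues_cfc_mem_image hAJ hfA i)
  have hfBI i := hfJ (hB.eigenvalues_cfc_mem_image hBJ hfB i)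
  have hfABI i := hfJ (hAB.eigenvalues_cfc_mem_image hABJ hfAB i)
  have hle := hf n hn t ht A B hA hB hAB hAJ hBJ
  have hC : ((t : ℂ) • hA.cfc f + ((1 : ℂ) - (t : ℂ)) • hB.cfc f).IsHermitian := by
    simpa using hle.isHermitian.add hfAB
  have hCI := hfA.eigenvalues_convexCombination_mem hI ht hfB hC hfAI hfBI
  rw [hA.cfc_comp φ f hfA, hB.cfc_comp φ f hfB, hAB.cfc_comp φ f hfAB]
  simpa using (hφc n hn t ht _ _ hfA hfB hC hfAI hfBI).add
    (hφm n hn _ _ hfAB hC hfABI hCI hle)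
end

section
/- Let I ⊆ ℝ be a nondegenerate interval and let φ be both operator monotone and strongly operator convex on I. Let J ⊆ ℝ be a nondegenerate interval and let f be operator convex on J with f(J) ⊆ I. Then the composite φ∘f is strongly operator convex on J. -/
open Matrix Set
open scoped ComplexOrder

namespace Matrix

variable {n : Type*} [Fintype n] [DecidableEq n]

theorem IsHermitian.forall_eigenvalues_mem_iff {A : Matrix n n ℂ} (hA : A.IsHermitian)
    {S : Set ℝ} : (∀ i, hA.eigenvalues i ∈ S) ↔ spectrum ℝ A ⊆ S := by
  rw [hA.spectrum_real_eq_range_eigenvalues, Set.range_subset_iff]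

theorem continuousOn_spectrum_real (f : ℝ → ℝ) (A : Matrix n n ℂ) :
    ContinuousOn f (spectrum ℝ A) :=
  A.finite_real_spectrum.continuousOn f

/-- A single polynomial computes `f(A)` and `f(B)` simultaneously. -/
theorem IsHermitian.exists_polynomial_cfc_eq {A B : Matrix n n ℂ} (hA : A.IsHermitian)
    (hB : B.IsHermitian) (f : ℝ → ℝ) :
    ∃ q : Polynomial ℝ, _root_.cfc f A = q.aeval A ∧ _root_.cfc f B = q.aeval B := by
  classical
  set s := (A.finite_real_spectrum.union B.finite_real_spectrum).toFinset
  have hq : ∀ x ∈ s, (Lagrange.interpolate s id f).eval x = f x := fun x hx =>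
    Lagrange.eval_interpolate_at_node (v := id) f (Set.injOn_id _) hx
  refine ⟨Lagrange.interpolate s id f, ?_, ?_⟩
  · rw [← cfc_polynomial _ A hA]
    exact cfc_congr fun x hx => (hq x (by simp [s, hx])).symm
  · rw [← cfc_polynomial _ B hB]
    exact cfc_congr fun x hx => (hq x (by simp [s, hx])).symm

/-- An intertwining relation between Hermitian matrices passes to the functional calculus. -/
theorem IsHermitian.mul_cfc_eq_of_mul_eq {A B X : Matrix n n ℂ} (hA : A.IsHermitian)
    (hB : B.IsHermitian) (h : X * A = B * X) (f : ℝ → ℝ) :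
    X * _root_.cfc f A = _root_.cfc f B * X := by
  obtain ⟨q, hqA, hqB⟩ := hA.exists_polynomial_cfc_eq hB f
  rw [hqA, hqB]
  clear hqA hqB
  induction q using Polynomial.induction_on' with
  | add p q hp hq => rw [map_add, map_add, mul_add, add_mul, hp, hq]
  | monomial k a =>
    have hpow : X * A ^ k = B ^ k * X := SemiconjBy.pow_right (a := X) h k
    rw [Polynomial.aeval_monomial, Polynomial.aeval_monomial, ← Algebra.smul_def,
      ← Algebra.smul_def, mul_smul_comm, smul_mul_assoc, hpow]

/-- Points of the numerical range lie in every convex set containing the spectrum. -/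
theorem IsHermitian.mem_of_dotProduct_mulVec_eq {A : Matrix n n ℂ} (hA : A.IsHermitian)
    {S : Set ℝ} (hS : Convex ℝ S) (hAS : spectrum ℝ A ⊆ S) {w : n → ℂ} (hw : w ≠ 0) {r : ℝ}
    (h : star w ⬝ᵥ (A *ᵥ w) = (r : ℂ) * (star w ⬝ᵥ w)) : r ∈ S := by
  rw [← hA.forall_eigenvalues_mem_iff] at hAS
  set U : Matrix n n ℂ := (hA.eigenvectorUnitary : Matrix n n ℂ)
  have hUU : U * star U = 1 := Unitary.coe_mul_star_self hA.eigenvectorUnitary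
  set y := star U *ᵥ w with hy
  have hyw : U *ᵥ y = w := by rw [hy, mulVec_mulVec, hUU, one_mulVec]
  have hsw : star w ᵥ* U = star y := by
    rw [hy, star_mulVec, star_eq_conjTranspose, conjTranspose_conjTranspose]
  have hspec : A = U * diagonal (RCLike.ofReal ∘ hA.eigenvalues) * star U := by
    conv_lhs => rw [hA.spectral_theorem, Unitary.conjStarAlgAut_apply]
  have h1 : star w ⬝ᵥ (A *ᵥ w) = ((∑ i, ‖y i‖ ^ 2 * hA.eigenvalues i : ℝ) : ℂ) := by
    conv_lhs => rw [hspec]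
    rw [← mulVec_mulVec, ← mulVec_mulVec, ← hy, dotProduct_mulVec, hsw, dotProduct]
    push_cast
    refine Finset.sum_congr rfl fun i _ => ?_
    rw [mulVec_diagonal, ← Complex.conj_mul']
    simp
    ring
  have h2 : star w ⬝ᵥ w = ((∑ i, ‖y i‖ ^ 2 : ℝ) : ℂ) := by
    conv_lhs => rw [← hyw]
    rw [dotProduct_mulVec, hyw, hsw, dotProduct]
    push_cast
    refine Finset.sum_congr rfl fun i _ => ?_
    rw [← Complex.conj_mul']
    simp
  rw [h1, h2] at h
  have h3 : ∑ i, ‖y i‖ ^ 2 * hA.eigenvalues i = r * ∑ i, ‖y i‖ ^ 2 := by exact_mod_cast h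
  have hy0 : y ≠ 0 := fun h0 => hw (by rw [← hyw, h0, mulVec_zero])
  obtain ⟨j, hj⟩ := Function.ne_iff.mp hy0
  have hpos : 0 < ∑ i, ‖y i‖ ^ 2 :=
    Finset.sum_pos' (fun i _ => by positivity)
      ⟨j, Finset.mem_univ j, by have := norm_pos_iff.mpr hj; positivity⟩
  have hmem := hS.centerMass_mem (t := Finset.univ) (w := fun i => ‖y i‖ ^ 2)
    (fun i _ => by positivity) hpos (fun i _ => hAS i)
  convert hmem
  rw [Finset.centerMass]
  simp only [smul_eq_mul]
  rw [h3]
  field_simp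

/-- The compression of `A` by a projection `P`, completed by the scalar `c` on the complement,
has its spectrum in every convex set containing `c` and the spectrum of `A`. -/
theorem IsHermitian.spectrum_compression_subset {A P : Matrix n n ℂ} (hA : A.IsHermitian)
    (hP : P.IsHermitian) (hPP : P * P = P) {c : ℝ}
    (hK : (P * A * P + (c : ℂ) • (1 - P)).IsHermitian) {S : Set ℝ} (hS : Convex ℝ S)
    (hAS : spectrum ℝ A ⊆ S) (hc : c ∈ S) :
    spectrum ℝ (P * A * P + (c : ℂ) • (1 - P)) ⊆ S := by
  rw [← hK.forall_eigenvalues_mem_iff]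
  intro i
  set r := hK.eigenvalues i with hr
  set v : n → ℂ := ⇑(hK.eigenvectorBasis i) with hv
  have hv0 : v ≠ 0 := fun h0 =>
    (hK.eigenvectorBasis.orthonormal.ne_zero i) (by ext j; exact congrFun h0 j)
  have hKv : (P * A * P + (c : ℂ) • (1 - P)) *ᵥ v = (r : ℂ) • v := by
    rw [hv, hK.mulVec_eigenvectorBasis i]
    ext j
    simp [hr]
  have hPK : P * (P * A * P + (c : ℂ) • (1 - P)) = P * A * P := by
    simp only [mul_add, mul_smul_comm, mul_sub, mul_one, hPP, ← mul_assoc, sub_self, smul_zero,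
      add_zero]
  have hPv : (P * A * P) *ᵥ v = (r : ℂ) • (P *ᵥ v) := by
    rw [← hPK, ← mulVec_mulVec, hKv, mulVec_smul]
  by_cases hw : P *ᵥ v = 0
  · have h1 : (c : ℂ) • v = (r : ℂ) • v := by
      rw [← hKv, add_mulVec, hPv, hw, smul_mulVec, sub_mulVec, hw]
      simp
    have h2 : (c : ℂ) = r := smul_left_injective ℂ hv0 h1
    rwa [← Complex.ofReal_inj.mp h2]
  · refine hA.mem_of_dotProduct_mulVec_eq hS hAS hw ?_
    have hs : star (P *ᵥ v) = star v ᵥ* P := by rw [star_mulVec, hP.eq]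
    rw [hs, ← dotProduct_mulVec, ← dotProduct_mulVec, mulVec_mulVec, mulVec_mulVec, mulVec_mulVec,
      hPP, hPv, dotProduct_smul, smul_eq_mul]

theorem IsHermitian.compression_add_smul {A P : Matrix n n ℂ} (hA : A.IsHermitian)
    (hP : P.IsHermitian) (c : ℝ) : (P * A * P + (c : ℂ) • (1 - P)).IsHermitian := by
  simp [IsHermitian, hA.eq, hP.eq, mul_assoc]

end Matrix

/-- The Davis inequality: `P f(PHP + c(1-P)) P ≤ P f(H) P` for an operator convex function. -/
theorem OperatorConvexOn.compression_le {f : ℝ → ℝ} {J : Set ℝ} (hf : OperatorConvexOn f J)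
    {n : ℕ} (hn : 0 < n) {P H : Matrix (Fin n) (Fin n) ℂ} (hP : P.IsHermitian) (hPP : P * P = P)
    (hH : H.IsHermitian) (hHJ : spectrum ℝ H ⊆ J) (c : ℝ) :
    (P * cfc f H * P - P * cfc f (P * H * P + (c : ℂ) • (1 - P)) * P).PosSemidef := by
  have hK := hH.compression_add_smul hP c
  set K := P * H * P + (c : ℂ) • (1 - P) with hKdef
  set U := (2 : ℂ) • P - 1 with hU
  have hUh : Uᴴ = U := by simp [hU, hP.eq]
  have hUU : U * U = 1 := by
    simp only [hU, mul_sub, sub_mul, smul_mul_smul_comm, hPP, mul_one, one_mul]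
    module
  have hPU : P * U = P := by
    simp only [hU, mul_sub, mul_smul_comm, hPP, mul_one]
    module
  have hUP : U * P = P := by
    simp only [hU, sub_mul, smul_mul_assoc, hPP, one_mul]
    module
  have hB : (U * H * U).IsHermitian := by
    simp [IsHermitian, hH.eq, hUh, mul_assoc]
  have hBJ : spectrum ℝ (U * H * U) ⊆ J := by
    have := spectrum.units_conjugate (R := ℝ) (a := H) (u := ⟨U, U, hUU, hUU⟩)
    exact this.trans_subset hHJ
  have hD : (((1 / 2 : ℝ) : ℂ) • H + ((1 : ℂ) - ((1 / 2 : ℝ) : ℂ)) • (U * H * U)).IsHermitian := by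
    simp [IsHermitian, hH.eq, hUh, mul_assoc]
  have key := hf n hn (1 / 2) (by norm_num) H (U * H * U) hH hB hD
    (hH.forall_eigenvalues_mem_iff.mpr hHJ) (hB.forall_eigenvalues_mem_iff.mpr hBJ)
  rw [← hH.cfc_eq, ← hB.cfc_eq, ← hD.cfc_eq] at key
  set D := ((1 / 2 : ℝ) : ℂ) • H + ((1 : ℂ) - ((1 / 2 : ℝ) : ℂ)) • (U * H * U) with hDdef
  have hPK : P * K = P * H * P := by
    simp only [hKdef, mul_add, mul_smul_comm, mul_sub, mul_one, hPP, ← mul_assoc, sub_self,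
      smul_zero, add_zero]
  have hDP : D * P = P * H * P := by
    rw [hDdef, add_mul, smul_mul_assoc, smul_mul_assoc, mul_assoc, hUP, hU]
    simp only [sub_mul, smul_mul_assoc, one_mul]
    push_cast
    module
  have hfB : P * cfc f (U * H * U) * P = P * cfc f H * P := by
    have h1 : U * cfc f H = cfc f (U * H * U) * U :=
      hH.mul_cfc_eq_of_mul_eq hB (by rw [mul_assoc, mul_assoc, hUU, mul_one]) f
    calc P * cfc f (U * H * U) * P = P * (cfc f (U * H * U) * U) * P := by
          rw [mul_assoc, mul_assoc P (_ * _) P, mul_assoc _ U, hUP]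
      _ = P * cfc f H * P := by rw [← h1, ← mul_assoc P U, hPU]
  have hfD : P * cfc f D * P = P * cfc f K * P := by
    have h1 : P * cfc f K = cfc f D * P := hK.mul_cfc_eq_of_mul_eq hD (hPK.trans hDP.symm) f
    rw [h1, mul_assoc, ← h1, ← mul_assoc, hPP, h1, mul_assoc, hPP]
  have := key.conjTranspose_mul_mul_same P
  rw [hP.eq] at this
  convert this using 1
  simp only [mul_sub, sub_mul, mul_add, add_mul, mul_smul_comm, smul_mul_assoc, hfB, hfD]
  push_cast
  module

/-- if `φ` is operator monotone and strongly operator convex on `I`, and `f` is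
operator convex on `J` with `f(J) ⊆ I`, then `φ∘f` is strongly operator convex on `J`. -/
theorem stmt10 (I : Set ℝ) (hI : Convex ℝ I) (hnt : I.Nontrivial)
    (φ : ℝ → ℝ) (hφm : OperatorMonotoneOn φ I) (hφs : StronglyOperatorConvexOn φ I)
    (J : Set ℝ) (hJ : Convex ℝ J) (hJnt : J.Nontrivial)
    (f : ℝ → ℝ) (hf : OperatorConvexOn f J) (hfJ : f '' J ⊆ I) :
    StronglyOperatorConvexOn (φ ∘ f) J := by
  obtain ⟨x₀, hx₀, hφ⟩ := hφs
  obtain ⟨y₀, hy₀⟩ := hJnt.nonempty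
  refine ⟨y₀, hy₀, fun n hn P H hP hPP hH hK hHJ => ?_⟩
  rw [hH.forall_eigenvalues_mem_iff] at hHJ
  have hKJ := hH.spectrum_compression_subset hP hPP hK hJ hHJ hy₀
  have hdavis := hf.compression_le hn hP hPP hH hHJ y₀
  rw [← hH.cfc_eq, ← hK.cfc_eq]
  set K := P * H * P + (y₀ : ℂ) • (1 - P) with hKdef
  have hspec : ∀ {A : Matrix (Fin n) (Fin n) ℂ}, A.IsHermitian → spectrum ℝ A ⊆ J →
      spectrum ℝ (cfc f A) ⊆ I := fun {A} hA hAJ => by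
    rw [cfc_map_spectrum f A hA.isSelfAdjoint (continuousOn_spectrum_real f A)]
    exact (Set.image_mono hAJ).trans hfJ
  have hcomp : ∀ {A : Matrix (Fin n) (Fin n) ℂ}, A.IsHermitian →
      cfc (φ ∘ f) A = cfc φ (cfc f A) := fun {A} hA =>
    cfc_comp φ f A hA ((A.finite_real_spectrum.image f).continuousOn φ)
      (continuousOn_spectrum_real f A)
  have hfH : (cfc f H).IsHermitian := cfc_predicate f H
  have hfK : (cfc f K).IsHermitian := cfc_predicate f K
  have hL := hfH.compression_add_smul hP x₀
  have hM := hfK.compression_add_smul hP x₀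
  have hstrong := hφ n hn P (cfc f H) hP hPP hfH hL
    (hfH.forall_eigenvalues_mem_iff.mpr (hspec hH hHJ))
  have hmono := hφm n hn _ _ hM hL
    (hM.forall_eigenvalues_mem_iff.mpr
      (hfK.spectrum_compression_subset hP hPP hM hI (hspec hK hKJ) hx₀))
    (hL.forall_eigenvalues_mem_iff.mpr
      (hfH.spectrum_compression_subset hP hPP hL hI (hspec hH hHJ) hx₀))
    (by simpa only [add_sub_add_right_eq_sub] using hdavis)
  rw [← hL.cfc_eq, ← hM.cfc_eq] at hmono
  rw [← hfH.cfc_eq, ← hL.cfc_eq] at hstrong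
  have hPK : P * K = K * P := by
    simp only [hKdef, mul_add, add_mul, mul_smul_comm, smul_mul_assoc, mul_sub, sub_mul, mul_one,
      one_mul, hPP, mul_assoc]
    simp only [← mul_assoc, hPP]
  have hPfK : P * cfc f K = cfc f K * P := hK.mul_cfc_eq_of_mul_eq hK hPK f
  have hfM : P * cfc φ (P * cfc f K * P + (x₀ : ℂ) • (1 - P)) = cfc φ (cfc f K) * P := by
    refine hM.mul_cfc_eq_of_mul_eq hfK ?_ φ
    simp only [mul_add, mul_smul_comm, mul_sub, mul_one, hPP, ← mul_assoc, sub_self, smul_zero,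
      add_zero]
    rw [hPfK, mul_assoc, hPP]
  have hfin : P * cfc φ (cfc f K) * P =
      P * cfc φ (P * cfc f K * P + (x₀ : ℂ) • (1 - P)) * P := by
    rw [hfM, mul_assoc, ← hfM, ← mul_assoc, hPP, hfM, mul_assoc, hPP]
  rw [hcomp hH, hcomp hK, hfin]
  have hconj := hmono.conjTranspose_mul_mul_same P
  rw [hP.eq, mul_sub, sub_mul] at hconj
  simpa only [sub_add_sub_cancel] using hstrong.add hconj
end

section
/- For every α with 0 < α < 1, the function f : (0,∞) → ℝ defined by f(x) = (x^(α−1) − 1)/(x^α − 1) for x ≠ 1 and f(1) = (α−1)/α is operator monotone on (0,∞). -/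
open Matrix Set
open scoped ComplexOrder

section StrictlyPositive

variable {A : Type*} [CStarAlgebra A] [PartialOrder A] [StarOrderedRing A]

lemma IsStrictlyPositive.spectrum_subset_Ioi {a : A} (ha : IsStrictlyPositive a) :
    spectrum ℝ a ⊆ Ioi 0 :=
  (CStarAlgebra.isStrictlyPositive_iff_isSelfAdjoint_and_spectrum_pos.mp ha).2

lemma cfc_isStrictlyPositive_of_pos {f : ℝ → ℝ} (hf : ContinuousOn f (Ioi 0))
    (hpos : ∀ x, 0 < x → 0 < f x) {a : A} (ha : IsStrictlyPositive a) :
    IsStrictlyPositive (cfc f a) :=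
  (cfc_isStrictlyPositive_iff f a (hf.mono ha.spectrum_subset_Ioi)
    ha.nonneg.isSelfAdjoint).mpr fun x hx => hpos x (ha.spectrum_subset_Ioi hx)

lemma cfc_inv_of_pos {f : ℝ → ℝ} (hf : ContinuousOn f (Ioi 0))
    (hpos : ∀ x, 0 < x → 0 < f x) {a : A} (ha : IsStrictlyPositive a) :
    cfc (fun x => (f x)⁻¹) a = Ring.inverse (cfc f a) :=
  cfc_inv f a (fun x hx => (hpos x (ha.spectrum_subset_Ioi hx)).ne')
    (hf.mono ha.spectrum_subset_Ioi) ha.nonneg.isSelfAdjoint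

lemma AntitoneOn.cfc_inv {f : ℝ → ℝ} (hf : ContinuousOn f (Ioi 0)) (hpos : ∀ x, 0 < x → 0 < f x)
    (h : AntitoneOn (fun a : A => cfc f a) {a | IsStrictlyPositive a}) :
    MonotoneOn (fun a : A => cfc (fun x => (f x)⁻¹) a) {a | IsStrictlyPositive a} := by
  intro a ha b hb hab
  simp only [cfc_inv_of_pos hf hpos ha, cfc_inv_of_pos hf hpos hb]
  exact CStarAlgebra.ringInverse_le_ringInverse (h ha hb hab)
    (cfc_isStrictlyPositive_of_pos hf hpos hb)

lemma MonotoneOn.cfc_inv {f : ℝ → ℝ} (hf : ContinuousOn f (Ioi 0)) (hpos : ∀ x, 0 < x → 0 < f x)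
    (h : MonotoneOn (fun a : A => cfc f a) {a | IsStrictlyPositive a}) :
    AntitoneOn (fun a : A => cfc (fun x => (f x)⁻¹) a) {a | IsStrictlyPositive a} := by
  intro a ha b hb hab
  simp only [cfc_inv_of_pos hf hpos ha, cfc_inv_of_pos hf hpos hb]
  exact CStarAlgebra.ringInverse_le_ringInverse (h ha hb hab)
    (cfc_isStrictlyPositive_of_pos hf hpos ha)

lemma antitoneOn_cfc_const_mul_inv_add {c t : ℝ} (hc : 0 ≤ c) (ht : 0 < t) :
    AntitoneOn (fun a : A => cfc (fun x => c * (t + x)⁻¹) a) {a | IsStrictlyPositive a} := by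
  have hcont : ContinuousOn (fun x : ℝ => t + x) (Ioi 0) := by fun_prop
  have hpos : ∀ x : ℝ, 0 < x → 0 < t + x := fun x hx => by positivity
  have hmono : MonotoneOn (fun a : A => cfc (fun x : ℝ => t + x) a) {a | IsStrictlyPositive a} := by
    intro a ha b hb hab
    have ha' : IsSelfAdjoint a := ha.nonneg.isSelfAdjoint
    have hb' : IsSelfAdjoint b := hb.nonneg.isSelfAdjoint
    simp only [cfc_const_add t (fun x => x) a, cfc_const_add t (fun x => x) b, cfc_id' ℝ a,
      cfc_id' ℝ b]
    gcongr
  intro a ha b hb hab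
  have hinv : ContinuousOn (fun x : ℝ => (t + x)⁻¹) (Ioi 0) :=
    hcont.inv₀ fun x hx => (hpos x hx).ne'
  simp only [cfc_const_mul c _ a (hinv.mono ha.spectrum_subset_Ioi),
    cfc_const_mul c _ b (hinv.mono hb.spectrum_subset_Ioi)]
  exact smul_le_smul_of_nonneg_left (hmono.cfc_inv hcont hpos ha hb hab) hc

end StrictlyPositive

section Slope

open Real MeasureTheory Filter Topology

lemma rpowIntegrand₀₁_one_mul_nonneg_le {p t x : ℝ} (hp : 0 < p) (ht : 0 < t) (hx : 0 < x) :
    0 ≤ rpowIntegrand₀₁ p t 1 * t * (t + x)⁻¹ ∧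
      rpowIntegrand₀₁ p t 1 * t * (t + x)⁻¹ ≤ rpowIntegrand₀₁ p t 1 := by
  have h0 := rpowIntegrand₀₁_nonneg hp ht.le zero_le_one
  refine ⟨by positivity, ?_⟩
  rw [mul_assoc, ← div_eq_mul_inv]
  exact mul_le_of_le_one_right h0 ((div_le_one (by positivity)).mpr (by linarith))

lemma continuousOn_rpowIntegrand₀₁_one_mul {p : ℝ} (hp : p ∈ Ioo 0 1) :
    ContinuousOn (Function.uncurry fun t x : ℝ => rpowIntegrand₀₁ p t 1 * t * (t + x)⁻¹)
      (Ioi 0 ×ˢ Ioi 0) := by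
  have h1 : ContinuousOn (fun q : ℝ × ℝ => rpowIntegrand₀₁ p q.1 1) (Ioi 0 ×ˢ Ioi 0) :=
    (continuousOn_rpowIntegrand₀₁ hp zero_le_one).comp continuousOn_fst fun q hq => hq.1
  refine (h1.mul continuousOn_fst).mul (ContinuousOn.inv₀ (by fun_prop) ?_)
  rintro ⟨t, x⟩ ⟨ht, hx⟩
  exact (add_pos ht hx).ne'

/-- The difference quotient of `x ↦ x ^ p` at `1` is a Stieltjes transform. -/
lemma exists_measure_dslope_rpow_eq_integral {p : ℝ} (hp : p ∈ Ioo 0 1) :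
    ∃ μ : Measure ℝ, IntegrableOn (fun t => rpowIntegrand₀₁ p t 1) (Ioi 0) μ ∧
      ∀ x, 0 < x → dslope (fun y : ℝ => y ^ p) 1 x =
        ∫ t in Ioi 0, rpowIntegrand₀₁ p t 1 * t * (t + x)⁻¹ ∂μ := by
  obtain ⟨μ, hμ⟩ := exists_measure_rpow_eq_integral_rpowIntegrand₀₁ hp
  have h_int := (hμ 1 (mem_Ici.mpr zero_le_one)).1
  refine ⟨μ, h_int, ?_⟩
  have hne : ∀ x, 0 < x → x ≠ 1 → dslope (fun y : ℝ => y ^ p) 1 x =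
      ∫ t in Ioi 0, rpowIntegrand₀₁ p t 1 * t * (t + x)⁻¹ ∂μ := by
    intro x hx hx1
    have hx1' : x - 1 ≠ 0 := sub_ne_zero.mpr hx1
    rw [dslope_of_ne _ hx1, slope_def_field, (hμ x hx.le).2, (hμ 1 (mem_Ici.mpr zero_le_one)).2,
      ← integral_sub (hμ x hx.le).1 h_int, div_eq_iff hx1', ← integral_mul_const]
    refine setIntegral_congr_fun measurableSet_Ioi fun t (ht : 0 < t) => ?_
    have h1 : t + x ≠ 0 := by positivity
    have h2 : t + 1 ≠ 0 := by positivity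
    simp only [rpowIntegrand₀₁]
    field_simp
    ring
  have hcont : ContinuousAt
      (fun x => ∫ t in Ioi 0, rpowIntegrand₀₁ p t 1 * t * (t + x)⁻¹ ∂μ) 1 := by
    have hev : ∀ᶠ x : ℝ in 𝓝 1, 0 < x := lt_mem_nhds one_pos
    refine continuousAt_of_dominated (bound := fun t => rpowIntegrand₀₁ p t 1) ?_ ?_ h_int ?_
    · filter_upwards [hev] with x hx
      exact ((continuousOn_rpowIntegrand₀₁_one_mul hp).uncurry_right x hx).aestronglyMeasurable
        measurableSet_Ioi
    · filter_upwards [hev] with x hx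
      filter_upwards [ae_restrict_mem measurableSet_Ioi] with t ht
      obtain ⟨h0, h1⟩ := rpowIntegrand₀₁_one_mul_nonneg_le hp.1 ht hx
      rwa [norm_of_nonneg h0]
    · filter_upwards [ae_restrict_mem measurableSet_Ioi] with t ht
      exact ((continuousOn_rpowIntegrand₀₁_one_mul hp).uncurry_left t ht).continuousAt
        (Ioi_mem_nhds one_pos)
  have hcont' : ContinuousAt (dslope (fun y : ℝ => y ^ p) 1) 1 :=
    continuousAt_dslope_same.mpr (differentiableAt_rpow_const_of_ne p one_ne_zero)
  intro x hx
  rcases eq_or_ne x 1 with rfl | hx1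
  · refine tendsto_nhds_unique (hcont'.tendsto.mono_left nhdsWithin_le_nhds)
      ((hcont.tendsto.mono_left nhdsWithin_le_nhds).congr' ?_) (l := 𝓝[≠] 1)
    filter_upwards [self_mem_nhdsWithin, nhdsWithin_le_nhds (lt_mem_nhds one_pos)] with y hy1 hy
    exact (hne y hy hy1).symm
  · exact hne x hx hx1

lemma continuousOn_dslope_rpow (p : ℝ) :
    ContinuousOn (dslope (fun y : ℝ => y ^ p) 1) (Ioi 0) :=
  (continuousOn_dslope (Ioi_mem_nhds one_pos)).mpr
    ⟨fun x hx => (continuousAt_rpow_const x p (.inl (ne_of_gt hx))).continuousWithinAt,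
      differentiableAt_rpow_const_of_ne p one_ne_zero⟩

lemma dslope_rpow_one (p : ℝ) : dslope (fun y : ℝ => y ^ p) 1 1 = p := by
  simp [(hasDerivAt_rpow_const (p := p) (.inl one_ne_zero) : HasDerivAt _ _ (1 : ℝ)).deriv]

lemma dslope_rpow_mem_Ioo {p x : ℝ} (hp : p ∈ Ioo 0 1) (hx : 0 < x) :
    dslope (fun y : ℝ => y ^ p) 1 x ∈ Ioo 0 1 := by
  obtain ⟨hp0, hp1⟩ := hp
  rcases lt_trichotomy x 1 with h | rfl | h
  · have h1 := rpow_lt_one hx.le h hp0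
    have h2 := rpow_lt_rpow_of_exponent_gt hx h hp1
    rw [rpow_one] at h2
    rw [dslope_of_ne _ h.ne, slope_def_field, one_rpow]
    exact ⟨div_pos_of_neg_of_neg (by linarith) (by linarith),
      (div_lt_one_of_neg (by linarith)).mpr (by linarith)⟩
  · rw [dslope_rpow_one]
    exact ⟨hp0, hp1⟩
  · have h1 := one_lt_rpow h hp0
    have h2 := rpow_lt_rpow_of_exponent_lt h hp1
    rw [rpow_one] at h2
    rw [dslope_of_ne _ h.ne', slope_def_field, one_rpow]
    exact ⟨div_pos (by linarith) (by linarith), (div_lt_one (by linarith)).mpr (by linarith)⟩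

lemma eq_neg_inv_inv_dslope_rpow_sub_one {α x : ℝ} (hα0 : 0 < α) (hα1 : α < 1) (hx : 0 < x) :
    (if x = 1 then (α - 1) / α else (x ^ (α - 1) - 1) / (x ^ α - 1)) =
      -((dslope (fun y : ℝ => y ^ (1 - α)) 1 x)⁻¹ - 1)⁻¹ := by
  split_ifs with h
  · subst h
    have : 1 - α ≠ 0 := by linarith
    rw [dslope_rpow_one, show (1 - α)⁻¹ - 1 = α / (1 - α) by field_simp; ring, inv_div]
    ring
  · have hne : ∀ q : ℝ, q ≠ 0 → x ^ q ≠ 1 := fun q hq h' =>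
      h ((rpow_left_inj hx.le zero_le_one hq).mp (h'.trans (one_rpow q).symm))
    have h1 : x ^ α - 1 ≠ 0 := sub_ne_zero.mpr (hne α hα0.ne')
    have h2 : x ^ (1 - α) - 1 ≠ 0 := sub_ne_zero.mpr (hne _ (by linarith))
    have h3 : x - 1 ≠ 0 := sub_ne_zero.mpr h
    have hpow : x ^ (1 - α) = x / x ^ α := by rw [rpow_sub hx, rpow_one]
    have hpow' : x ^ (α - 1) = x ^ α / x := by rw [rpow_sub hx, rpow_one]
    have hpos : 0 < x ^ α := rpow_pos_of_pos hx α
    rw [dslope_of_ne _ h, slope_def_field, one_rpow, inv_div, div_sub_one h2, inv_div, ← neg_div,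
      hpow']
    rw [hpow] at h2 ⊢
    have h4 : x - 1 - (x / x ^ α - 1) ≠ 0 := by
      rw [show x - 1 - (x / x ^ α - 1) = x * (x ^ α - 1) / x ^ α by field_simp; ring]
      positivity
    rw [div_eq_div_iff h1 h4]
    field_simp
    ring

variable {A : Type*} [CStarAlgebra A] [PartialOrder A] [StarOrderedRing A]

lemma antitoneOn_cfc_dslope_rpow {p : ℝ} (hp : p ∈ Ioo 0 1) :
    AntitoneOn (fun a : A => cfc (dslope (fun y : ℝ => y ^ p) 1) a) {a | IsStrictlyPositive a} := by
  obtain ⟨μ, h_int, hμ⟩ := exists_measure_dslope_rpow_eq_integral hp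
  have hbound : ∀ a : A, IsStrictlyPositive a → ∀ᵐ t ∂(μ.restrict (Ioi 0)), ∀ x ∈ spectrum ℝ a,
      ‖rpowIntegrand₀₁ p t 1 * t * (t + x)⁻¹‖ ≤ rpowIntegrand₀₁ p t 1 := by
    intro a ha
    filter_upwards [ae_restrict_mem measurableSet_Ioi] with t ht x hx
    obtain ⟨h0, h1⟩ := rpowIntegrand₀₁_one_mul_nonneg_le hp.1 ht (ha.spectrum_subset_Ioi hx)
    rwa [norm_of_nonneg h0]
  have hcont : ∀ a : A, IsStrictlyPositive a → ContinuousOn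
      (Function.uncurry fun t x : ℝ => rpowIntegrand₀₁ p t 1 * t * (t + x)⁻¹)
      (Ioi 0 ×ˢ spectrum ℝ a) := fun a ha =>
    (continuousOn_rpowIntegrand₀₁_one_mul hp).mono (prod_mono_right ha.spectrum_subset_Ioi)
  refine AntitoneOn.congr (integral_antitoneOn_of_integrand_ae (μ := μ.restrict (Ioi 0))
    (f := fun t (a : A) => cfc (fun x => rpowIntegrand₀₁ p t 1 * t * (t + x)⁻¹) a) ?_ ?_) ?_
  · filter_upwards [ae_restrict_mem measurableSet_Ioi] with t (ht : 0 < t)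
    exact antitoneOn_cfc_const_mul_inv_add
      (mul_nonneg (rpowIntegrand₀₁_nonneg hp.1 ht.le zero_le_one) ht.le) ht
  · exact fun a ha => integrableOn_cfc measurableSet_Ioi _ _ a (hcont a ha) (hbound a ha) h_int.2
      ha.nonneg.isSelfAdjoint
  · intro a ha
    dsimp only
    rw [← cfc_setIntegral measurableSet_Ioi _ _ a (hcont a ha) (hbound a ha) h_int.2
      ha.nonneg.isSelfAdjoint]
    exact cfc_congr fun x hx => (hμ x (ha.spectrum_subset_Ioi hx)).symm

lemma monotoneOn_cfc_rpow_sub_one_div {α : ℝ} (hα0 : 0 < α) (hα1 : α < 1) :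
    MonotoneOn (fun a : A => cfc
      (fun x : ℝ => if x = 1 then (α - 1) / α else (x ^ (α - 1) - 1) / (x ^ α - 1)) a)
      {a | IsStrictlyPositive a} := by
  have hp : 1 - α ∈ Ioo 0 1 := ⟨by linarith, by linarith⟩
  set g := dslope (fun y : ℝ => y ^ (1 - α)) 1
  have hgc : ContinuousOn g (Ioi 0) := continuousOn_dslope_rpow _
  have hg0 : ∀ x, 0 < x → 0 < g x := fun x hx => (dslope_rpow_mem_Ioo hp hx).1
  have hgi : ContinuousOn (fun x => (g x)⁻¹) (Ioi 0) := hgc.inv₀ fun x hx => (hg0 x hx).ne'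
  have hk0 : ∀ x, 0 < x → 0 < (g x)⁻¹ - 1 := fun x hx =>
    sub_pos.mpr ((one_lt_inv₀ (hg0 x hx)).mpr (dslope_rpow_mem_Ioo hp hx).2)
  have hkc : ContinuousOn (fun x => (g x)⁻¹ - 1) (Ioi 0) := hgi.sub continuousOn_const
  have hk : MonotoneOn (fun a : A => cfc (fun x => (g x)⁻¹ - 1) a) {a | IsStrictlyPositive a} := by
    intro a ha b hb hab
    have ha' : IsSelfAdjoint a := ha.nonneg.isSelfAdjoint
    have hb' : IsSelfAdjoint b := hb.nonneg.isSelfAdjoint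
    simp only [cfc_sub _ (fun _ => (1 : ℝ)) a (hgi.mono ha.spectrum_subset_Ioi),
      cfc_sub _ (fun _ => (1 : ℝ)) b (hgi.mono hb.spectrum_subset_Ioi),
      cfc_const_one ℝ a, cfc_const_one ℝ b]
    exact sub_le_sub_right ((antitoneOn_cfc_dslope_rpow hp).cfc_inv hgc hg0 ha hb hab) 1
  refine (hk.cfc_inv hkc hk0).neg.congr fun a ha => ?_
  change -cfc _ a = cfc _ a
  rw [← cfc_neg]
  exact cfc_congr fun x hx =>
    (eq_neg_inv_inv_dslope_rpow_sub_one hα0 hα1 (ha.spectrum_subset_Ioi hx)).symm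

end Slope

/-- for `0 < α < 1`, the function `x ↦ (x^(α−1) − 1)/(x^α − 1)` (with value
`(α−1)/α` at `x = 1`) is operator monotone on `(0,∞)`. -/
theorem stmt12 (α : ℝ) (hα0 : 0 < α) (hα1 : α < 1) :
    OperatorMonotoneOn
      (fun x => if x = 1 then (α - 1) / α else (x ^ (α - 1) - 1) / (x ^ α - 1))
      (Set.Ioi (0 : ℝ)) := by
  open scoped MatrixOrder Matrix.Norms.L2Operator in
  intro n _ A B hA hB hAI hBI hAB
  have hpos : ∀ {C : Matrix (Fin n) (Fin n) ℂ} (hC : C.IsHermitian),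
      (∀ i, hC.eigenvalues i ∈ Ioi (0 : ℝ)) → IsStrictlyPositive C := fun hC hCI =>
    (hC.posDef_iff_eigenvalues_pos.mpr hCI).isStrictlyPositive
  rw [← hA.cfc_eq, ← hB.cfc_eq, ← Matrix.le_iff]
  exact monotoneOn_cfc_rpow_sub_one_div hα0 hα1 (hpos hA hAI) (hpos hB hBI) hAB
end
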